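/- arXiv:1803.09003 — 4 statements merged into one kernel-verified Lean document; each statement's English description precedes it below -/
import Mathlib

section
/- Every binary pattern P that avoids all four patterns Q₁, Q₂, Q₃, Q₄ as interval minors is row-bounding, i.e., the class Av(P) is row-bounded. -/
/-!
Common framework: binary matrices, interval minors, criticality, 0-runs,
row/column complexity, embeddings and related notions, following
Jelínek–Kučera, "On the structure of matrices avoiding interval-minor
patterns". All indices are 0-based.
-/

/-- A binary matrix: dimensions `m × n`, with entries given by a total
function (entries outside the range `[0,m) × [0,n)` are irrelevant:
all definitions below only inspect in-range entries). -/
structure BMat where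
  m : ℕ
  n : ℕ
  entry : ℕ → ℕ → Bool

namespace BMat

/-- The support of a binary matrix: its set of (in-range) 1-entries. -/
def supp (M : BMat) : Set (ℕ × ℕ) :=
  {p | p.1 < M.m ∧ p.2 < M.n ∧ M.entry p.1 p.2 = true}

/-- `M'` is obtained from `M` by contracting two adjacent rows `r`, `r+1`. -/
def RowCon (M M' : BMat) : Prop :=
  ∃ r, r + 1 < M.m ∧ M'.m + 1 = M.m ∧ M'.n = M.n ∧
    ∀ i j, i < M'.m → j < M'.n →
      M'.entry i j =
        if i < r then M.entry i j
        else if i = r then (M.entry r j || M.entry (r + 1) j)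
        else M.entry (i + 1) j

/-- `M'` is obtained from `M` by contracting two adjacent columns `c`, `c+1`. -/
def ColCon (M M' : BMat) : Prop :=
  ∃ c, c + 1 < M.n ∧ M'.n + 1 = M.n ∧ M'.m = M.m ∧
    ∀ i j, i < M'.m → j < M'.n →
      M'.entry i j =
        if j < c then M.entry i j
        else if j = c then (M.entry i c || M.entry i (c + 1))
        else M.entry i (j + 1)

/-- One contraction step (of a row or of a column). -/
def Con (M M' : BMat) : Prop := RowCon M M' ∨ ColCon M M'

/-- `P` is an interval minor of `M`: `M` can be transformed by a sequence of
row and column contractions into a matrix of the same dimensions as `P`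
dominating `P`. -/
def IntervalMinor (P M : BMat) : Prop :=
  ∃ M', Relation.ReflTransGen Con M M' ∧ M'.m = P.m ∧ M'.n = P.n ∧
    ∀ i j, i < P.m → j < P.n → P.entry i j = true → M'.entry i j = true

/-- `M` avoids `P` as an interval minor. -/
def Avoids (P M : BMat) : Prop := ¬ IntervalMinor P M

/-- The class of all matrices avoiding `P` as an interval minor. -/
def Av (P : BMat) : Set BMat := {M | Avoids P M}

/-- The class of all matrices avoiding every pattern of `F` as an interval
minor. -/
def AvF (F : Set BMat) : Set BMat := {M | ∀ P ∈ F, Avoids P M}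

/-- The matrix obtained from `M` by changing the entry at position `(i, j)`
into a 1-entry. -/
def setOne (M : BMat) (i j : ℕ) : BMat :=
  ⟨M.m, M.n, fun a b => if a = i ∧ b = j then true else M.entry a b⟩

/-- `M` is critical for the class `C`: it lies in `C`, but changing any
single 0-entry of `M` into a 1-entry leaves `C`. -/
def CriticalFor (C : Set BMat) (M : BMat) : Prop :=
  M ∈ C ∧ ∀ i j, i < M.m → j < M.n → M.entry i j = false → setOne M i j ∉ C

/-- The number of horizontal 0-runs in row `r` of `M`, counted via their
starting columns. -/
noncomputable def rowRunCount (M : BMat) (r : ℕ) : ℕ :=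
  Set.ncard {j | j < M.n ∧ M.entry r j = false ∧ (j = 0 ∨ M.entry r (j - 1) = true)}

/-- The number of vertical 0-runs in column `c` of `M`. -/
noncomputable def colRunCount (M : BMat) (c : ℕ) : ℕ :=
  Set.ncard {i | i < M.m ∧ M.entry i c = false ∧ (i = 0 ∨ M.entry (i - 1) c = true)}

/-- A class is row-bounded if there is a uniform bound on the number of
0-runs in any row of any matrix that is critical for the class. -/
def RowBounded (C : Set BMat) : Prop :=
  ∃ K, ∀ M, CriticalFor C M → ∀ r, r < M.m → rowRunCount M r ≤ K

/-- A class is column-bounded if there is a uniform bound on the number of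
0-runs in any column of any matrix that is critical for the class. -/
def ColBounded (C : Set BMat) : Prop :=
  ∃ K, ∀ M, CriticalFor C M → ∀ c, c < M.n → colRunCount M c ≤ K

/-- A class is bounded if it is both row-bounded and column-bounded. -/
def Bounded (C : Set BMat) : Prop := RowBounded C ∧ ColBounded C

/-- The pattern `Q₁`, with support `{(1,2),(2,1),(3,3)}` (1-based). -/
def Q1 : BMat :=
  ⟨3, 3, fun i j => (i == 0 && j == 1) || (i == 1 && j == 0) || (i == 2 && j == 2)⟩

/-- The pattern `Q₂`, with support `{(1,2),(2,3),(3,1)}` (1-based). -/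
def Q2 : BMat :=
  ⟨3, 3, fun i j => (i == 0 && j == 1) || (i == 1 && j == 2) || (i == 2 && j == 0)⟩

/-- The pattern `Q₃`, with support `{(1,1),(2,3),(3,2)}` (1-based). -/
def Q3 : BMat :=
  ⟨3, 3, fun i j => (i == 0 && j == 0) || (i == 1 && j == 2) || (i == 2 && j == 1)⟩

/-- The pattern `Q₄`, with support `{(1,3),(2,1),(3,2)}` (1-based). -/
def Q4 : BMat :=
  ⟨3, 3, fun i j => (i == 0 && j == 2) || (i == 1 && j == 0) || (i == 2 && j == 1)⟩

/-- The diagonal pattern `D_k`, with support `{(i,i) : i ∈ [k]}`. -/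
def D (k : ℕ) : BMat := ⟨k, k, fun i j => i == j⟩

/-- The antidiagonal pattern `D̄_k`, with support `{(i, k+1-i) : i ∈ [k]}`
(1-based). -/
def Dbar (k : ℕ) : BMat := ⟨k, k, fun i j => i + j + 1 == k⟩

/-- An embedding of `P` into `M`: 1-entries go to 1-entries, and the map is
strictly monotone in rows and in columns. -/
def IsEmbedding (P M : BMat) (φ : ℕ → ℕ → ℕ × ℕ) : Prop :=
  (∀ i j, i < P.m → j < P.n → (φ i j).1 < M.m ∧ (φ i j).2 < M.n) ∧
  (∀ i j, i < P.m → j < P.n → P.entry i j = true →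
      M.entry (φ i j).1 (φ i j).2 = true) ∧
  (∀ i₁ j₁ i₂ j₂, i₁ < P.m → j₁ < P.n → i₂ < P.m → j₂ < P.n →
      (i₁ < i₂ → (φ i₁ j₁).1 < (φ i₂ j₂).1) ∧
      (j₁ < j₂ → (φ i₁ j₁).2 < (φ i₂ j₂).2))

/-- A partition of `M` containing `P` (via row indices `r 0 < ⋯ < r P.m ≤ M.m`
and column indices `c 0 < ⋯ < c P.n ≤ M.n`). -/
def PartitionContains (M P : BMat) : Prop :=
  ∃ r c : ℕ → ℕ,
    (∀ i, i < P.m → r i < r (i + 1)) ∧ (∀ j, j < P.n → c j < c (j + 1)) ∧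
    r P.m ≤ M.m ∧ c P.n ≤ M.n ∧
    ∀ i j, i < P.m → j < P.n → P.entry i j = true →
      ∃ a b, r i ≤ a ∧ a < r (i + 1) ∧ c j ≤ b ∧ b < c (j + 1) ∧
        M.entry a b = true

/-- A partial embedding of `P` into `M`, defined on a nonempty set `S` of
entries of `P`. -/
def IsPartialEmbedding (P M : BMat) (S : Set (ℕ × ℕ)) (ψ : ℕ × ℕ → ℕ × ℕ) : Prop :=
  S.Nonempty ∧ (∀ e ∈ S, e.1 < P.m ∧ e.2 < P.n) ∧
  (∀ i j, i < P.m → j < P.n → P.entry i j = true →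
      (i, j) ∈ S ∧ M.entry (ψ (i, j)).1 (ψ (i, j)).2 = true) ∧
  (∀ e ∈ S, (ψ e).1 < M.m ∧ (ψ e).2 < M.n ∧
      e.1 ≤ (ψ e).1 ∧ e.2 ≤ (ψ e).2 ∧
      P.m - 1 - e.1 ≤ M.m - 1 - (ψ e).1 ∧ P.n - 1 - e.2 ≤ M.n - 1 - (ψ e).2) ∧
  (∀ e₁ ∈ S, ∀ e₂ ∈ S,
      (e₁.1 < e₂.1 → e₂.1 - e₁.1 ≤ (ψ e₂).1 - (ψ e₁).1) ∧
      (e₁.2 < e₂.2 → e₂.2 - e₁.2 ≤ (ψ e₂).2 - (ψ e₁).2))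

/-- A horizontal 0-run of `M` in row `r`, occupying exactly columns
`c₁, …, c₂`. -/
def ZeroRun (M : BMat) (r c₁ c₂ : ℕ) : Prop :=
  r < M.m ∧ c₁ ≤ c₂ ∧ c₂ < M.n ∧
  (∀ j, c₁ ≤ j → j ≤ c₂ → M.entry r j = false) ∧
  (c₁ = 0 ∨ M.entry r (c₁ - 1) = true) ∧
  (c₂ + 1 = M.n ∨ M.entry r (c₂ + 1) = true)

/-- The 0-entry `f` of `M` is critical for the 1-entry `e` of `P`: some
embedding of `P` into `M △ f` maps `e` to `f`. -/
def CritEntry (P : BMat) (e : ℕ × ℕ) (M : BMat) (f : ℕ × ℕ) : Prop :=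
  f.1 < M.m ∧ f.2 < M.n ∧ M.entry f.1 f.2 = false ∧
  ∃ φ, IsEmbedding P (setOne M f.1 f.2) φ ∧ φ e.1 e.2 = f

/-- The number of horizontal 0-runs in row `r` of `M` that are critical for
the 1-entry `e` of `P` (counted via their starting columns). -/
noncomputable def critRunCount (P : BMat) (e : ℕ × ℕ) (M : BMat) (r : ℕ) : ℕ :=
  Set.ncard {c₁ | ∃ c₂, ZeroRun M r c₁ c₂ ∧
    ∃ c, c₁ ≤ c ∧ c ≤ c₂ ∧ CritEntry P e M (r, c)}

/-- The 1-entry `e` of `P` is row-bounding: every row of every `P`-avoiding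
matrix contains a bounded number of 0-runs critical for `e`. -/
def EntryRowBounding (P : BMat) (e : ℕ × ℕ) : Prop :=
  ∃ K, ∀ M, Avoids P M → ∀ r, critRunCount P e M r ≤ K

/-- An increasing walk from `e` to `e'`: a sequence of positions, each step
moving one column to the right or one row up, with `W` its set of
positions. -/
def IsIncreasingWalk (W : Set (ℕ × ℕ)) (e e' : ℕ × ℕ) : Prop :=
  ∃ (t : ℕ) (f : ℕ → ℕ × ℕ), f 0 = e ∧ f t = e' ∧
    W = {x | ∃ i, i ≤ t ∧ f i = x} ∧
    ∀ i, i < t →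
      ((f (i + 1)).1 = (f i).1 ∧ (f (i + 1)).2 = (f i).2 + 1) ∨
      ((f (i + 1)).1 + 1 = (f i).1 ∧ (f (i + 1)).2 = (f i).2)

/-- All 1-entries of `P` can be covered by at most `k` lines
(rows or columns). -/
def CoveredByLines (P : BMat) (k : ℕ) : Prop :=
  ∃ (R C : Finset ℕ), R.card + C.card ≤ k ∧
    ∀ i j, i < P.m → j < P.n → P.entry i j = true → i ∈ R ∨ j ∈ C

/-- Clockwise rotation by 90 degrees. -/
def rot90 (P : BMat) : BMat := ⟨P.n, P.m, fun i j => P.entry (P.m - 1 - j) i⟩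

/-- Rotation by 180 degrees. -/
def rot180 (P : BMat) : BMat :=
  ⟨P.m, P.n, fun i j => P.entry (P.m - 1 - i) (P.n - 1 - j)⟩

/-- Clockwise rotation by 270 degrees. -/
def rot270 (P : BMat) : BMat := ⟨P.n, P.m, fun i j => P.entry j (P.n - 1 - i)⟩

/-- Reflection turning the matrix upside down (reversing the rows). -/
def reflRows (P : BMat) : BMat := ⟨P.m, P.n, fun i j => P.entry (P.m - 1 - i) j⟩

/-- Reflection reversing the columns. -/
def reflCols (P : BMat) : BMat := ⟨P.m, P.n, fun i j => P.entry i (P.n - 1 - j)⟩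

/-- Reflection along the main diagonal (transposition). -/
def transposeB (P : BMat) : BMat := ⟨P.n, P.m, fun i j => P.entry j i⟩

/-- Reflection along the antidiagonal. -/
def antitransposeB (P : BMat) : BMat :=
  ⟨P.n, P.m, fun i j => P.entry (P.m - 1 - j) (P.n - 1 - i)⟩

/-- Type 1 pattern of Lemma `lem-2types`: rows `r < r' < r''`, columns
`c < c'`, with `supp ⊆ ({r'} × [c,c']) ∪ {(r,c),(r'',c),(r,c'),(r'',c')}`. -/
def TypeOne (P₀ : BMat) : Prop :=
  ∃ r r' r'' c c', r < r' ∧ r' < r'' ∧ r'' < P₀.m ∧ c < c' ∧ c' < P₀.n ∧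
    ∀ i j, i < P₀.m → j < P₀.n → P₀.entry i j = true →
      (i = r' ∧ c ≤ j ∧ j ≤ c') ∨ ((i = r ∨ i = r'') ∧ (j = c ∨ j = c'))

/-- Type 2 pattern of Lemma `lem-2types`: rows `r < r'`, columns `c < c'`,
with `supp ⊆ ({r} × [c,c']) ∪ ({r'} × [1,c]) ∪ ([1,r] × {c'}) ∪ {(r',c')}`. -/
def TypeTwo (P₀ : BMat) : Prop :=
  ∃ r r' c c', r < r' ∧ r' < P₀.m ∧ c < c' ∧ c' < P₀.n ∧
    ∀ i j, i < P₀.m → j < P₀.n → P₀.entry i j = true →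
      (i = r ∧ c ≤ j ∧ j ≤ c') ∨ (i = r' ∧ j ≤ c) ∨ (i ≤ r ∧ j = c') ∨
      (i = r' ∧ j = c')

/-- A minor-closed class of binary matrices. -/
def MinorClosed (C : Set BMat) : Prop :=
  ∀ M ∈ C, ∀ P, IntervalMinor P M → P ∈ C

/-- The 4×3 pattern with support `{(1,2),(2,1),(3,2),(4,3)}` (1-based), from
Proposition `pro-counter`. -/
def P18 : BMat :=
  ⟨4, 3, fun i j => (i == 0 && j == 1) || (i == 1 && j == 0) ||
    (i == 2 && j == 1) || (i == 3 && j == 2)⟩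

end BMat

open BMat


structure Sys where
  P : ℤ → ℤ → Prop
  M : ℤ → ℤ → Prop
  p0 : ℤ
  p1 : ℤ
  c0 : ℤ
  c1 : ℤ
  x0 : ℤ
  x1 : ℤ
  y0 : ℤ
  y1 : ℤ
  i : ℤ
  j : ℤ
  r : ℤ

def CutOK (p0 p1 x0 x1 : ℤ) (R : ℤ → ℤ) : Prop :=
  (∀ s t, p0 ≤ s → s < t → t ≤ p1 → R s < R t) ∧ x0 ≤ R p0 ∧ R p1 ≤ x1

namespace Sys

def Row (S : Sys) (R : ℤ → ℤ) : Prop :=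
  CutOK S.p0 S.p1 S.x0 S.x1 R ∧ R S.i ≤ S.r ∧ S.r < R (S.i + 1)

def Cont (S : Sys) : Prop :=
  ∃ R C, CutOK S.p0 S.p1 S.x0 S.x1 R ∧ CutOK S.c0 S.c1 S.y0 S.y1 C ∧
    ∀ i j, S.P i j → ∃ a b, R i ≤ a ∧ a < R (i + 1) ∧ C j ≤ b ∧ b < C (j + 1) ∧ S.M a b

structure Hole (S : Sys) (R C : ℤ → ℤ) : Prop where
  row : S.Row R
  col : CutOK S.c0 S.c1 S.y0 S.y1 C
  wit : ∀ i j, S.P i j → ¬ (i = S.i ∧ j = S.j) →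
    ∃ a b, R i ≤ a ∧ a < R (i + 1) ∧ C j ≤ b ∧ b < C (j + 1) ∧ S.M a b

structure Pat (S : Sys) : Prop where
  e : S.P S.i S.j
  rng : ∀ i j, S.P i j → S.p0 ≤ i ∧ i < S.p1 ∧ S.c0 ≤ j ∧ j < S.c1
  n213 : ∀ a1 b1 a2 b2 a3 b3, S.P a1 b1 → S.P a2 b2 → S.P a3 b3 → a1 < a2 → a2 < a3 →
    b2 < b1 → b1 < b3 → False
  n231 : ∀ a1 b1 a2 b2 a3 b3, S.P a1 b1 → S.P a2 b2 → S.P a3 b3 → a1 < a2 → a2 < a3 →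
    b3 < b1 → b1 < b2 → False
  n132 : ∀ a1 b1 a2 b2 a3 b3, S.P a1 b1 → S.P a2 b2 → S.P a3 b3 → a1 < a2 → a2 < a3 →
    b1 < b3 → b3 < b2 → False
  n312 : ∀ a1 b1 a2 b2 a3 b3, S.P a1 b1 → S.P a2 b2 → S.P a3 b3 → a1 < a2 → a2 < a3 →
    b2 < b3 → b3 < b1 → False

structure Chain (S : Sys) (N : ℕ) (R C : ℕ → ℤ → ℤ) (q : ℕ → ℤ) : Prop where
  hole : ∀ k < N, S.Hole (R k) (C k)
  gap : ∀ k, k + 1 < N → C k (S.j + 1) ≤ q k ∧ q k < C (k + 1) S.j ∧ S.M S.r (q k)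

theorem cut_le {p0 p1 x0 x1 : ℤ} {R : ℤ → ℤ} (h : CutOK p0 p1 x0 x1 R) {s t : ℤ}
    (h0 : p0 ≤ s) (h1 : s ≤ t) (h2 : t ≤ p1) : R s ≤ R t := by
  rcases h1.eq_or_lt with rfl | h1
  · exact le_rfl
  · exact (h.1 s t h0 h1 h2).le

theorem Chain.qmono {S : Sys} (hS : S.Pat) {N R C q} (h : S.Chain N R C q) :
    ∀ k l, k < l → l + 1 < N → q k < q l := by
  intro k l hkl
  have := hS.rng _ _ hS.e
  induction l, hkl using Nat.le_induction with
  | base =>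
    intro hl
    rw [Nat.succ_eq_add_one] at *
    have h1 := h.gap k (by omega)
    have h2 := h.gap (k+1) hl
    have h3 := (h.hole (k+1) (by omega)).col.1 S.j (S.j+1) (by omega) (by omega) (by omega)
    omega
  | succ l hl ih =>
    intro hN
    have h0 := ih (by omega)
    have h1 := h.gap l (by omega)
    have h2 := h.gap (l+1) hN
    have h3 := (h.hole (l+1) (by omega)).col.1 S.j (S.j+1) (by omega) (by omega) (by omega)
    omega

theorem Chain.qle {S : Sys} (hS : S.Pat) {N R C q} (h : S.Chain N R C q)
    (k l) (hkl : k ≤ l) (hl : l + 1 < N) : q k ≤ q l := by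
  rcases hkl.eq_or_lt with rfl | h1
  · exact le_rfl
  · exact (h.qmono hS k l h1 hl).le

/-- Gluing two embeddings. -/
theorem glue {S : Sys} (hS : S.Pat) {R C R' C' : ℤ → ℤ} (hk : S.Hole R C) (hl : S.Hole R' C')
    (q : ℕ → ℤ) (L : ℕ) (hL : S.c1 - S.c0 ≤ L)
    (hq0 : C (S.j + 1) ≤ q 0) (hq : ∀ s ≤ L, S.M S.r (q s) ∧ q s < C' S.j)
    (hqm : ∀ s t, s < t → t ≤ L → q s < q t)
    (up lo : ℤ → ℤ) (hup : S.Row up) (hlo : S.Row lo) (a b : ℤ) (ha0 : S.c0 ≤ a)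
    (ha : a ≤ S.j) (hb : S.j ≤ b) (hb1 : b < S.c1)
    (hU : ∀ i j, S.P i j → i < S.i → (j ≤ a ∧ up i ≤ R i ∧ R (i+1) ≤ up (i+1)) ∨
      (b ≤ j ∧ up i ≤ R' i ∧ R' (i+1) ≤ up (i+1)))
    (hD : ∀ i j, S.P i j → S.i < i → (j ≤ a ∧ lo i ≤ R i ∧ R (i+1) ≤ lo (i+1)) ∨
      (b ≤ j ∧ lo i ≤ R' i ∧ R' (i+1) ≤ lo (i+1)))
    (hM : ∀ j, S.P S.i j → (a ≤ j ∧ j ≤ b) ∨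
      (j < a ∧ up S.i ≤ R S.i ∧ R (S.i+1) ≤ lo (S.i+1)) ∨
      (b < j ∧ up S.i ≤ R' S.i ∧ R' (S.i+1) ≤ lo (S.i+1))) : S.Cont := by
  have he := hS.rng _ _ hS.e
  have hqz : ∀ s, s ≤ L → q 0 ≤ q s := by
    intro s hs
    rcases Nat.eq_zero_or_pos s with rfl | h
    · exact le_rfl
    · exact (hqm 0 s h hs).le
  have hCq : ∀ t, S.c0 ≤ t → t ≤ S.j + 1 → C t ≤ q 0 := fun t h0 h1 =>
    (cut_le hk.col h0 h1 (by omega)).trans hq0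
  have hCq' : ∀ t s, S.j ≤ t → t ≤ S.c1 → s ≤ L → q s < C' t := fun t s h0 h1 hs =>
    (hq s hs).2.trans_le (cut_le hl.col (by omega) h0 h1)
  set g : ℤ → ℤ := fun t => if t ≤ a then C t else if t ≤ b then q (t - a).toNat else C' t with hg
  set f : ℤ → ℤ := fun t => if t ≤ S.i then up t else lo t with hf
  have hgm : ∀ s t, S.c0 ≤ s → s < t → t ≤ S.c1 → g s < g t := by
    intro s t h0 hst h1
    simp only [hg]
    split_ifs with h2 h3 h4 h5 h6 h7 h8
    · exact hk.col.1 s t h0 hst h1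
    · have := hCq s h0 (by omega)
      have := hqm 0 (t-a).toNat (by omega) (by omega)
      omega
    · have := hCq s h0 (by omega)
      have := hCq' t 0 (by omega) h1 (by omega)
      omega
    · omega
    · exact hqm _ _ (by omega) (by omega)
    · exact hCq' t _ (by omega) h1 (by omega)
    · omega
    · omega
    · exact hl.col.1 s t h0 hst h1
  have hfm : ∀ s t, S.p0 ≤ s → s < t → t ≤ S.p1 → f s < f t := by
    intro s t h0 hst h1
    simp only [hf]
    split_ifs with h2 h3 h4
    · exact hup.1.1 s t h0 hst h1
    · have := cut_le hup.1 h0 h2 (by omega)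
      have := cut_le hlo.1 (s := S.i+1) (t := t) (by omega) (by omega) (by omega)
      have := hup.2.1
      have := hlo.2.2
      omega
    · omega
    · exact hlo.1.1 s t h0 hst h1
  have keyA : ∀ j, S.c0 ≤ j → j ≤ a → g j = C j ∧ C (j+1) ≤ g (j+1) := by
    intro j h0 h1
    refine ⟨by simp [hg, h1], ?_⟩
    simp only [hg]
    split_ifs with h2 h3
    · exact le_rfl
    · exact (hCq _ (by omega) (by omega)).trans (hqz _ (by omega))
    · have := hCq (j+1) (by omega) (by omega)
      have := hCq' (j+1) 0 (by omega) (by omega) (by omega)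
      omega
  have keyB : ∀ j, b ≤ j → j < S.c1 → g j ≤ C' j ∧ C' (j+1) ≤ g (j+1) := by
    intro j h0 h1
    constructor
    · simp only [hg]
      split_ifs with h2 h3
      · have := hCq j (by omega) (by omega)
        have := hCq' j 0 (by omega) (by omega) (by omega)
        omega
      · exact (hCq' j _ (by omega) (by omega) (by omega)).le
      · exact le_rfl
    · simp only [hg]
      rw [if_neg (by omega), if_neg (by omega)]
  have keyM : ∀ j, a ≤ j → j ≤ b → ∃ y, g j ≤ y ∧ y < g (j+1) ∧ S.M S.r y := by
    intro j h0 h1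
    refine ⟨q (j-a).toNat, ?_, ?_, (hq _ (by omega)).1⟩
    · simp only [hg]
      split_ifs with h2
      · exact (hCq j (by omega) (by omega)).trans (hqz _ (by omega))
      · exact le_rfl
    · simp only [hg]
      rw [if_neg (by omega)]
      split_ifs with h2
      · exact hqm _ _ (by omega) (by omega)
      · exact hCq' _ _ (by omega) (by omega) (by omega)
  have fu : ∀ t, t ≤ S.i → f t = up t := fun t h => by simp [hf, h]
  have fl : ∀ t, S.i < t → f t = lo t := fun t h => by simp [hf, h]
  have useA : ∀ i j, S.P i j → ¬ (i = S.i ∧ j = S.j) → j ≤ a → f i ≤ R i → R (i+1) ≤ f (i+1) →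
      ∃ x y, f i ≤ x ∧ x < f (i + 1) ∧ g j ≤ y ∧ y < g (j + 1) ∧ S.M x y := by
    intro i j hP hne hj h1 h2
    obtain ⟨x, y, h3, h4, h5, h6, h7⟩ := hk.wit i j hP hne
    have h8 := keyA j (hS.rng _ _ hP).2.2.1 hj
    exact ⟨x, y, by omega, by omega, by omega, by omega, h7⟩
  have useB : ∀ i j, S.P i j → ¬ (i = S.i ∧ j = S.j) → b ≤ j → f i ≤ R' i → R' (i+1) ≤ f (i+1) →
      ∃ x y, f i ≤ x ∧ x < f (i + 1) ∧ g j ≤ y ∧ y < g (j + 1) ∧ S.M x y := by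
    intro i j hP hne hj h1 h2
    obtain ⟨x, y, h3, h4, h5, h6, h7⟩ := hl.wit i j hP hne
    have h8 := keyB j hj (hS.rng _ _ hP).2.2.2
    exact ⟨x, y, by omega, by omega, by omega, by omega, h7⟩
  refine ⟨f, g, ⟨hfm, ?_, ?_⟩, ⟨hgm, ?_, ?_⟩, ?_⟩
  · rw [fu _ (by omega)]; exact hup.1.2.1
  · rw [fl _ (by omega)]; exact hlo.1.2.2
  · simp only [hg]; rw [if_pos ha0]; exact hk.col.2.1
  · simp only [hg]; rw [if_neg (by omega), if_neg (by omega)]; exact hl.col.2.2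
  intro i j hP
  rcases lt_trichotomy i S.i with h | h | h
  · rcases hU i j hP h with ⟨h1, h2, h3⟩ | ⟨h1, h2, h3⟩
    · exact useA i j hP (by omega) h1 (by rwa [fu _ (by omega)]) (by rwa [fu _ (by omega)])
    · exact useB i j hP (by omega) h1 (by rwa [fu _ (by omega)]) (by rwa [fu _ (by omega)])
  · subst h
    rcases hM j hP with ⟨h1, h2⟩ | ⟨h1, h2, h3⟩ | ⟨h1, h2, h3⟩
    · obtain ⟨y, h3, h4, h5⟩ := keyM j h1 h2
      refine ⟨S.r, y, ?_, ?_, h3, h4, h5⟩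
      · rw [fu _ le_rfl]; exact hup.2.1
      · rw [fl _ (by omega)]; exact hlo.2.2
    · exact useA _ j hP (by omega) h1.le (by rwa [fu _ (by omega)]) (by rwa [fl _ (by omega)])
    · exact useB _ j hP (by omega) h1.le (by rwa [fu _ (by omega)]) (by rwa [fl _ (by omega)])
  · rcases hD i j hP h with ⟨h1, h2, h3⟩ | ⟨h1, h2, h3⟩
    · exact useA i j hP (by omega) h1 (by rwa [fl _ (by omega)]) (by rwa [fl _ (by omega)])
    · exact useB i j hP (by omega) h1 (by rwa [fl _ (by omega)]) (by rwa [fl _ (by omega)])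

def hull (R R' : ℤ → ℤ) (x t : ℤ) : ℤ :=
  if t ≤ x then (if R x ≤ R' x then R t else R' t)
  else (if R' (x+1) ≤ R (x+1) then R t else R' t)

theorem hull_or (R R' : ℤ → ℤ) (x t : ℤ) : hull R R' x t = R t ∨ hull R R' x t = R' t := by
  unfold hull; split_ifs <;> simp

theorem hull_row {S : Sys} {R R' : ℤ → ℤ} (x : ℤ) (h0 : S.p0 ≤ x) (h1 : x < S.p1)
    (h : S.Row R) (h' : S.Row R') : S.Row (hull R R' x) := by
  refine ⟨⟨?_, ?_, ?_⟩, ?_, ?_⟩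
  · intro s t hs hst ht
    have a1 := h.1.1 s t hs hst ht
    have a2 := h'.1.1 s t hs hst ht
    by_cases hx : s ≤ x ∧ x < t
    · have b1 := cut_le h.1 hs hx.1 (by omega)
      have b2 := cut_le h'.1 hs hx.1 (by omega)
      have b3 := cut_le h.1 (s := x+1) (t := t) (by omega) (by omega) ht
      have b4 := cut_le h'.1 (s := x+1) (t := t) (by omega) (by omega) ht
      have b5 := h.1.1 x (x+1) h0 (by omega) (by omega)
      have b6 := h'.1.1 x (x+1) h0 (by omega) (by omega)
      unfold hull; split_ifs <;> omega
    · unfold hull; split_ifs <;> omega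
  · have := h.1.2.1; have := h'.1.2.1
    rcases hull_or R R' x S.p0 with e | e <;> rw [e] <;> assumption
  · have := h.1.2.2; have := h'.1.2.2
    rcases hull_or R R' x S.p1 with e | e <;> rw [e] <;> assumption
  · have := h.2.1; have := h'.2.1
    rcases hull_or R R' x S.i with e | e <;> rw [e] <;> assumption
  · have := h.2.2; have := h'.2.2
    rcases hull_or R R' x (S.i+1) with e | e <;> rw [e] <;> assumption

theorem hull_at (R R' : ℤ → ℤ) (x : ℤ) : hull R R' x x ≤ R x ∧ hull R R' x x ≤ R' x ∧
    R (x+1) ≤ hull R R' x (x+1) ∧ R' (x+1) ≤ hull R R' x (x+1) := by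
  unfold hull; split_ifs <;> omega

theorem hull_ne (R R' : ℤ → ℤ) (x t : ℤ) (h : t ≠ x) :
    (hull R R' x t = R t ∧ hull R R' x (t+1) = R (t+1)) ∨
    (hull R R' x t = R' t ∧ hull R R' x (t+1) = R' (t+1)) := by
  unfold hull; split_ifs <;> omega

def Good (S : Sys) (T : ℤ → Prop) (a b : ℤ) : Prop :=
  (∀ i j, S.P i j → T i → j ≤ a) ∨ (∀ i j, S.P i j → T i → b ≤ j) ∨
  (∃ x, S.p0 ≤ x ∧ x < S.p1 ∧
    ∀ i j, S.P i j → T i → (i = x ∧ (j ≤ a ∨ b ≤ j)) ∨ (b ≤ j ∧ j ≤ a))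

theorem good_side {S : Sys} {T : ℤ → Prop} {a b : ℤ} (hG : S.Good T a b) {R R' : ℤ → ℤ}
    (h : S.Row R) (h' : S.Row R') : ∃ f, S.Row f ∧
    ∀ i j, S.P i j → T i → (j ≤ a ∧ f i ≤ R i ∧ R (i+1) ≤ f (i+1)) ∨
      (b ≤ j ∧ f i ≤ R' i ∧ R' (i+1) ≤ f (i+1)) := by
  rcases hG with hG | hG | ⟨x, h0, h1, hG⟩
  · exact ⟨R, h, fun i j hP hT => Or.inl ⟨hG i j hP hT, le_rfl, le_rfl⟩⟩
  · exact ⟨R', h', fun i j hP hT => Or.inr ⟨hG i j hP hT, le_rfl, le_rfl⟩⟩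
  · refine ⟨hull R R' x, hull_row x h0 h1 h h', ?_⟩
    intro i j hP hT
    have h2 := hull_at R R' x
    rcases hG i j hP hT with ⟨rfl, h3⟩ | h3
    · omega
    · by_cases hx : i = x
      · subst hx; omega
      · have := hull_ne R R' x i hx
        omega

/-- Zone lemma. -/
theorem zone {S : Sys} (hS : S.Pat) {N R C q} (h : S.Chain N R C q) (u w : ℕ)
    (hw : S.c1 - S.c0 + 2 ≤ w) (hN : u + w + 1 < N)
    (hz : ∀ i a b, i ≠ S.i → S.p0 ≤ i → i < S.p1 → R (u+1) i ≤ a → a < R (u+1) (i+1) →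
      (∃ j, S.P i j) → q u ≤ b → b < q (u+w) → ¬ S.M a b) : S.Cont := by
  have he := hS.rng _ _ hS.e
  have hk := h.hole (u+1) (by omega)
  set C' := C (u+1) with hC'
  set g : ℤ → ℤ := fun t => if C' t ≤ q u ∨ q (u+w) ≤ C' t then C' t
    else q (u + 1 + (t - S.c0).toNat) with hg
  have hq1 : ∀ t, S.c0 ≤ t → t ≤ S.c1 → q u < q (u + 1 + (t - S.c0).toNat) ∧
      q (u + 1 + (t - S.c0).toNat) < q (u + w) := fun t h0 h1 =>
    ⟨h.qmono hS _ _ (by omega) (by omega), h.qmono hS _ _ (by omega) (by omega)⟩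
  have huw := h.qmono hS u (u+w) (by omega) hN
  have g0 := h.gap u (by omega)
  have g1 := h.gap (u+1) (by omega)
  have g2 := h.qle hS (u+1) (u+w) (by omega) hN
  have hjj := hk.col.1 S.j (S.j+1) (by omega) (by omega) (by omega)
  rw [← hC'] at g0 g1
  have hgm : ∀ s t, S.c0 ≤ s → s < t → t ≤ S.c1 → g s < g t := by
    intro s t h0 hst h1
    have a1 := hk.col.1 s t h0 hst h1
    have a2 := hq1 s h0 (by omega)
    have a3 := hq1 t (by omega) h1
    have a4 := h.qmono hS (u + 1 + (s - S.c0).toNat) (u + 1 + (t - S.c0).toNat)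
      (by omega) (by omega)
    simp only [hg]
    split_ifs <;> omega
  refine ⟨R (u+1), g, hk.row.1, ⟨hgm, ?_, ?_⟩, ?_⟩
  · have a1 := hk.col.2.1
    have a2 := hq1 S.c0 le_rfl (by omega)
    have a3 := (h.hole u (by omega)).col.2.1
    have a4 := cut_le (h.hole u (by omega)).col (s := S.c0) (t := S.j+1) le_rfl (by omega) (by omega)
    have a5 := h.gap u (by omega)
    simp only [hg]
    split_ifs <;> omega
  · have a1 := hk.col.2.2
    have a2 := hq1 S.c1 (by omega) le_rfl
    simp only [hg]
    split_ifs with h3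
    · omega
    · have a3 := (h.hole (u+w+1) (by omega)).col.2.2
      have a4 := cut_le (h.hole (u+w+1) (by omega)).col (s := S.j) (t := S.c1) (by omega) (by omega) le_rfl
      have a5 := h.gap (u+w) (by omega)
      omega
  intro i j hP
  have hr := hS.rng _ _ hP
  have a2 := hq1 j hr.2.2.1 (by omega)
  have a3 := hq1 (j+1) (by omega) (by omega)
  have a4 := h.qmono hS (u + 1 + (j - S.c0).toNat) (u + 1 + (j + 1 - S.c0).toNat)
      (by omega) (by omega)
  have a5 := hk.col.1 j (j+1) (by omega) (by omega) (by omega)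
  by_cases hi : i = S.i
  · subst hi
    by_cases hlow : C' (j+1) ≤ q u ∨ q (u+w) ≤ C' j
    · obtain ⟨a, b, w1, w2, w3, w4, w5⟩ := hk.wit _ j hP (by
        rintro ⟨-, rfl⟩; omega)
      refine ⟨a, b, w1, w2, ?_, ?_, w5⟩ <;> simp only [hg] <;> split_ifs <;> omega
    · by_cases hl2 : C' j ≤ q u
      · refine ⟨S.r, q u, hk.row.2.1, hk.row.2.2, ?_, ?_, (h.gap u (by omega)).2.2⟩ <;>
          simp only [hg] <;> split_ifs <;> omega
      · refine ⟨S.r, q (u + 1 + (j - S.c0).toNat), hk.row.2.1, hk.row.2.2, ?_, ?_,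
          (h.gap _ (by omega)).2.2⟩ <;>
          simp only [hg] <;> split_ifs <;> omega
  · obtain ⟨a, b, w1, w2, w3, w4, w5⟩ := hk.wit _ j hP (by omega)
    have hb : b < q u ∨ q (u+w) ≤ b := by
      by_contra hcon
      exact hz i a b hi hr.1 hr.2.1 w1 w2 ⟨j, hP⟩ (by omega) (by omega) w5
    refine ⟨a, b, w1, w2, ?_, ?_, w5⟩ <;> simp only [hg] <;> split_ifs <;> omega

theorem tworow {S : Sys} (hS : S.Pat) {N R C q} (h : S.Chain N R C q) (n : ℕ)
    (hn : S.c1 - S.c0 = n) (hN : N = n * (n+2) + 2) (i1 : ℤ) (hi1 : i1 < S.i) (hp : S.p0 ≤ i1)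
    (hrow : ∀ i j, S.P i j → i = i1 ∨ i = S.i) : S.Cont := by
  have he := hS.rng _ _ hS.e
  have hNe : (Finset.range N).Nonempty := ⟨0, by simp [hN]⟩
  obtain ⟨k0, hk0, hmin⟩ := Finset.exists_min_image (Finset.range N) (fun k => R k i1) hNe
  obtain ⟨k1, hk1, hmax⟩ := Finset.exists_max_image (Finset.range N) (fun k => R k (i1+1)) hNe
  simp only [Finset.mem_range] at hk0 hmin hk1 hmax
  by_cases hz : ∃ u, u + (n+2) + 1 < N ∧ ∀ a b, R k0 i1 ≤ a → a < R k1 (i1+1) → q u ≤ b →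
      b < q (u+(n+2)) → ¬ S.M a b
  · obtain ⟨u, hu, hz⟩ := hz
    refine zone hS h u (n+2) (by push_cast; omega) hu ?_
    rintro i a b hi - - h1 h2 ⟨j, hP⟩ h3 h4
    obtain rfl : i = i1 := by have := hrow i j hP; tauto
    have := hmin (u+1) (by omega)
    have := hmax (u+1) (by omega)
    exact hz a b (by omega) (by omega) h3 h4
  push Not at hz
  have H0 := h.hole k0 hk0
  have H1 := h.hole k1 hk1
  set f : ℤ → ℤ := fun t => if t ≤ i1 then R k0 t else R k1 t with hf
  set g : ℤ → ℤ := fun t => q ((t - S.c0).toNat * (n+2)) with hg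
  have hidx : ∀ t, S.c0 ≤ t → t ≤ S.c1 → (t - S.c0).toNat * (n+2) + 1 < N := by
    intro t h0 h1
    have : (t - S.c0).toNat ≤ n := by omega
    have := Nat.mul_le_mul_right (n+2) this
    omega
  have hgm : ∀ s t, S.c0 ≤ s → s < t → t ≤ S.c1 → g s < g t := by
    intro s t h0 hst h1
    exact h.qmono hS _ _ (Nat.mul_lt_mul_of_pos_right (by omega) (by omega)) (hidx t (by omega) h1)
  refine ⟨f, g, ⟨?_, ?_, ?_⟩, ⟨hgm, ?_, ?_⟩, ?_⟩
  · intro s t h0 hst h1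
    simp only [hf]
    split_ifs with h2 h3 h4
    · exact H0.row.1.1 s t h0 hst h1
    · have b1 := cut_le H0.row.1 h0 h2 (by omega)
      have b3 := cut_le H1.row.1 (s := i1+1) (t := t) (by omega) (by omega) h1
      have b5 := H0.row.1.1 i1 (i1+1) (by omega) (by omega) (by omega)
      have b6 := hmax k0 hk0
      omega
    · omega
    · exact H1.row.1.1 s t h0 hst h1
  · simp only [hf]; rw [if_pos hp]; exact H0.row.1.2.1
  · simp only [hf]; rw [if_neg (by omega)]; exact H1.row.1.2.2
  · have a3 := (h.hole 0 (by omega)).col.2.1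
    have a4 := cut_le (h.hole 0 (by omega)).col (s := S.c0) (t := S.j+1) le_rfl (by omega) (by omega)
    have a5 := h.gap 0 (by omega)
    simp only [hg]
    simp
    omega
  · have a0 := hidx S.c1 (by omega) le_rfl
    have a3 := (h.hole _ a0).col.2.2
    have a4 := cut_le (h.hole _ a0).col (s := S.j) (t := S.c1) (by omega) (by omega) le_rfl
    have a5 := h.gap _ a0
    simp only [hg]
    omega
  intro i j hP
  have hr := hS.rng _ _ hP
  have hs : (j + 1 - S.c0).toNat * (n+2) = (j - S.c0).toNat * (n+2) + (n+2) := by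
    have : (j + 1 - S.c0).toNat = (j - S.c0).toNat + 1 := by omega
    rw [this]; ring
  have hi2 := hidx (j+1) (by omega) (by omega)
  rcases hrow i j hP with rfl | rfl
  · obtain ⟨a, b, h1, h2, h3, h4, h5⟩ := hz ((j - S.c0).toNat * (n+2)) (by omega)
    refine ⟨a, b, ?_, ?_, h3, ?_, h5⟩
    · simpa [hf] using h1
    · simpa [hf] using h2
    · simp only [hg]; rw [hs]; exact h4
  · refine ⟨S.r, g j, ?_, ?_, le_rfl, hgm j (j+1) (by omega) (by omega) (by omega), ?_⟩
    · simp only [hf]; rw [if_neg (by omega)]; exact H1.row.2.1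
    · simp only [hf]; rw [if_neg (by omega)]; exact H1.row.2.2
    · exact (h.gap _ (by omega)).2.2

/-- The gluing lemma specialised to a chain. -/
theorem Chain.glue {S : Sys} (hS : S.Pat) {N R C q} (h : S.Chain N R C q) (n : ℕ)
    (hn : S.c1 - S.c0 = n) (hN : N = n * (n+2) + 2)
    (up lo : ℤ → ℤ) (hup : S.Row up) (hlo : S.Row lo) (a b : ℤ) (ha0 : S.c0 ≤ a)
    (ha : a ≤ S.j) (hb : S.j ≤ b) (hb1 : b < S.c1)
    (hU : ∀ i j, S.P i j → i < S.i → (j ≤ a ∧ up i ≤ R 0 i ∧ R 0 (i+1) ≤ up (i+1)) ∨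
      (b ≤ j ∧ up i ≤ R (N-1) i ∧ R (N-1) (i+1) ≤ up (i+1)))
    (hD : ∀ i j, S.P i j → S.i < i → (j ≤ a ∧ lo i ≤ R 0 i ∧ R 0 (i+1) ≤ lo (i+1)) ∨
      (b ≤ j ∧ lo i ≤ R (N-1) i ∧ R (N-1) (i+1) ≤ lo (i+1)))
    (hM : ∀ j, S.P S.i j → (a ≤ j ∧ j ≤ b) ∨
      (j < a ∧ up S.i ≤ R 0 S.i ∧ R 0 (S.i+1) ≤ lo (S.i+1)) ∨
      (b < j ∧ up S.i ≤ R (N-1) S.i ∧ R (N-1) (S.i+1) ≤ lo (S.i+1))) : S.Cont := by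
  have hle : n ≤ N - 2 := by
    have : n * 1 ≤ n * (n+2) := Nat.mul_le_mul_left n (by omega)
    omega
  refine Sys.glue hS (h.hole 0 (by omega)) (h.hole (N-1) (by omega)) q (N-2) (by omega)
    (h.gap 0 (by omega)).1 ?_ ?_ up lo hup hlo a b ha0 ha hb hb1 hU hD hM
  · intro s hs
    refine ⟨(h.gap s (by omega)).2.2, ?_⟩
    have h1 := h.qle hS s (N-2) hs (by omega)
    have h2 := (h.gap (N-2) (by omega)).2.1
    rw [show N - 2 + 1 = N - 1 by omega] at h2
    omega
  · intro s t hst ht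
    exact h.qmono hS s t hst (by omega)

theorem bad {S : Sys} (hS : S.Pat) {N R C q} (h : S.Chain N R C q) (n : ℕ)
    (hn : S.c1 - S.c0 = n) (hN : N = n * (n+2) + 2) (jL jR : ℤ)
    (hL : S.P S.i jL) (hL' : ∀ j, S.P S.i j → jL ≤ j)
    (hR : S.P S.i jR) (hR' : ∀ j, S.P S.i j → j ≤ jR)
    (hbad : ¬ S.Good (fun i => i < S.i) jL jR) : S.Cont := by
  have he := hS.rng _ _ hS.e
  have hLr := hS.rng _ _ hL
  have hRr := hS.rng _ _ hR
  have hLj := hL' _ hS.e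
  have hRj := hR' _ hS.e
  have r0 := (h.hole 0 (by omega)).row
  have r1 := (h.hole (N-1) (by omega)).row
  by_cases hright : ∃ ir jr, S.P ir jr ∧ ir ≠ S.i ∧ S.j < jr
  swap
  · push Not at hright
    refine h.glue hS n hn hN _ _ r0 r0 S.j (S.c1-1) (by omega) le_rfl (by omega) (by omega) ?_ ?_ ?_
    · intro i j hP hi
      exact Or.inl ⟨hright i j hP (by omega), le_rfl, le_rfl⟩
    · intro i j hP hi
      exact Or.inl ⟨hright i j hP (by omega), le_rfl, le_rfl⟩
    · intro j hP
      have := hS.rng _ _ hP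
      omega
  by_cases hleft : ∃ il jl, S.P il jl ∧ il ≠ S.i ∧ jl < S.j
  swap
  · push Not at hleft
    refine h.glue hS n hn hN _ _ r1 r1 S.c0 S.j (by omega) (by omega) (by omega) (by omega) ?_ ?_ ?_
    · intro i j hP hi
      exact Or.inr ⟨hleft i j hP (by omega), le_rfl, le_rfl⟩
    · intro i j hP hi
      exact Or.inr ⟨hleft i j hP (by omega), le_rfl, le_rfl⟩
    · intro j hP
      have := hS.rng _ _ hP
      omega
  obtain ⟨ir, jr, hPr, hir, hjr⟩ := hright
  obtain ⟨il, jl, hPl, hil, hjl⟩ := hleft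
  by_cases hNE : ∃ yi yj, S.P yi yj ∧ yi < S.i ∧ S.j < yj
  swap
  · exfalso
    push Not at hNE
    refine hbad (Or.inl ?_)
    intro i j hP hi
    by_contra hc
    have := hNE i j hP hi
    have : ¬ ir < S.i := fun hh => by have := hNE ir jr hPr hh; omega
    exact hS.n213 _ _ _ _ _ _ hP hL hPr hi (by omega) (by omega) (by omega)
  by_cases hNW : ∃ xi xj, S.P xi xj ∧ xi < S.i ∧ xj < S.j
  swap
  · exfalso
    push Not at hNW
    refine hbad (Or.inr (Or.inl ?_))
    intro i j hP hi
    by_contra hc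
    have := hNW i j hP hi
    have : ¬ il < S.i := fun hh => by have := hNW il jl hPl hh; omega
    exact hS.n231 _ _ _ _ _ _ hP hR hPl hi (by omega) (by omega) (by omega)
  obtain ⟨i1, xj, hx, hxi, hxj⟩ := hNW
  obtain ⟨yi, yj, hy, hyi, hyj⟩ := hNE
  have same : ∀ a b c d, S.P a b → S.P c d → a < S.i → c < S.i → b < S.j → S.j < d → a = c := by
    intro a b c d h1 h2 h3 h4 h5 h6
    rcases lt_trichotomy a c with hh | hh | hh
    · exact (hS.n132 _ _ _ _ _ _ h1 h2 hS.e hh h4 (by omega) (by omega)).elim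
    · exact hh
    · exact (hS.n312 _ _ _ _ _ _ h2 h1 hS.e hh h3 (by omega) (by omega)).elim
  obtain rfl := same _ _ _ _ hx hy hxi hyi hxj hyj
  have hrow : ∀ a b, S.P a b → a < S.i → a = i1 ∨ b = S.j := by
    intro a b h1 h2
    rcases lt_trichotomy b S.j with hh | hh | hh
    · exact Or.inl (same _ _ _ _ h1 hy h2 hyi hh hyj)
    · exact Or.inr hh
    · exact Or.inl (same _ _ _ _ hx h1 hxi h2 hxj hh).symm
  have hx0 := hS.rng _ _ hx
  have hLR : jL < S.j ∨ S.j < jR := by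
    by_contra hc
    refine hbad (Or.inr (Or.inr ⟨i1, hx0.1, hx0.2.1, ?_⟩))
    intro a b h1 h2
    have := hrow a b h1 h2
    omega
  have hUabove : ∀ u, S.P u S.j → ¬ u < i1 := by
    intro u hu hui
    rcases hLR with hh | hh
    · exact hS.n231 _ _ _ _ _ _ hu hy hL hui hxi hh hyj
    · exact hS.n213 _ _ _ _ _ _ hu hx hR hui hxi hxj hh
  have hDn : ∀ d, S.P d S.j → ¬ S.i < d := by
    intro d hd hdi
    rcases hLR with hh | hh
    · exact hS.n312 _ _ _ _ _ _ hy hL hd hxi hdi hh hyj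
    · exact hS.n132 _ _ _ _ _ _ hx hR hd hxi hdi hxj hh
  have SWc : ∀ z w, S.P z w → S.i < z → w < S.j → w ≤ jL := by
    intro z w hz h1 h2
    by_contra hc
    exact hS.n312 _ _ _ _ _ _ hy hL hz hxi h1 (by omega) (by omega)
  have SEc : ∀ z w, S.P z w → S.i < z → S.j < w → jR ≤ w := by
    intro z w hz h1 h2
    by_contra hc
    exact hS.n132 _ _ _ _ _ _ hx hR hz hxi h1 (by omega) (by omega)
  by_cases hUb : ∃ u, S.P u S.j ∧ i1 < u ∧ u < S.i
  · obtain ⟨u, hu, hu1, hu2⟩ := hUb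
    have NWc : ∀ a b, S.P a b → a < S.i → b < S.j → b ≤ jL := by
      intro a b h1 h2 h3
      by_contra hc
      have := hrow a b h1 h2
      exact hS.n231 _ _ _ _ _ _ h1 hu hL (by omega) hu2 (by omega) h3
    have NEc : ∀ a b, S.P a b → a < S.i → S.j < b → jR ≤ b := by
      intro a b h1 h2 h3
      by_contra hc
      have := hrow a b h1 h2
      exact hS.n213 _ _ _ _ _ _ h1 hu hR (by omega) hu2 (by omega) (by omega)
    have SWn : ∀ z w, S.P z w → S.i < z → w < S.j → jR = S.j := by
      intro z w hz h1 h2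
      by_contra hc
      exact hS.n231 _ _ _ _ _ _ hu hR hz hu2 h1 h2 (by omega)
    have SEn : ∀ z w, S.P z w → S.i < z → S.j < w → jL = S.j := by
      intro z w hz h1 h2
      by_contra hc
      exact hS.n213 _ _ _ _ _ _ hu hL hz hu2 h1 (by omega) h2
    have hh := hull_row (S := S) i1 hx0.1 hx0.2.1 r0 r1
    have hat := hull_at (R 0) (R (N-1)) i1
    by_cases hcmp : R (N-1) (i1+1) ≤ R 0 (i1+1)
    · -- use the left embedding for column `j`
      have hgt : ∀ t, i1 < t → hull (R 0) (R (N-1)) i1 t = R 0 t := by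
        intro t ht
        unfold hull
        rw [if_neg (by omega), if_pos hcmp]
      have hU : ∀ i j, S.P i j → i < S.i →
          (j ≤ S.j ∧ hull (R 0) (R (N-1)) i1 i ≤ R 0 i ∧
            R 0 (i+1) ≤ hull (R 0) (R (N-1)) i1 (i+1)) ∨
          (jR ≤ j ∧ hull (R 0) (R (N-1)) i1 i ≤ R (N-1) i ∧
            R (N-1) (i+1) ≤ hull (R 0) (R (N-1)) i1 (i+1)) := by
        intro i j hP hi
        by_cases hii : i = i1
        · subst hii
          have := NEc i j hP hi
          omega
        · have h3 := (hrow i j hP hi).resolve_left hii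
          subst h3
          have := hUabove i hP
          rw [hgt i (by omega), hgt (i+1) (by omega)]
          omega
      by_cases hSE : ∃ z w, S.P z w ∧ S.i < z ∧ S.j < w
      · obtain ⟨z, w, hz, hz1, hz2⟩ := hSE
        have e1 := SEn z w hz hz1 hz2
        refine h.glue hS n hn hN _ _ hh r1 S.j jR (by omega) le_rfl (by omega) (by omega) hU ?_ ?_
        · intro i j hP hi
          refine Or.inr ⟨?_, le_rfl, le_rfl⟩
          rcases lt_trichotomy j S.j with h5 | h5 | h5
          · have := SWn i j hP hi h5; omega
          · subst h5; exact (hDn i hP hi).elim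
          · exact SEc i j hP hi h5
        · intro j hP
          have := hL' j hP
          have := hR' j hP
          omega
      · push Not at hSE
        refine h.glue hS n hn hN _ _ hh r0 S.j jR (by omega) le_rfl (by omega) (by omega) hU ?_ ?_
        · intro i j hP hi
          exact Or.inl ⟨hSE i j hP hi, le_rfl, le_rfl⟩
        · intro j hP
          have := hR' j hP
          rw [hgt S.i (by omega)]
          omega
    · have hgt : ∀ t, i1 < t → hull (R 0) (R (N-1)) i1 t = R (N-1) t := by
        intro t ht
        unfold hull
        rw [if_neg (by omega), if_neg hcmp]
      have hU : ∀ i j, S.P i j → i < S.i →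
          (j ≤ jL ∧ hull (R 0) (R (N-1)) i1 i ≤ R 0 i ∧
            R 0 (i+1) ≤ hull (R 0) (R (N-1)) i1 (i+1)) ∨
          (S.j ≤ j ∧ hull (R 0) (R (N-1)) i1 i ≤ R (N-1) i ∧
            R (N-1) (i+1) ≤ hull (R 0) (R (N-1)) i1 (i+1)) := by
        intro i j hP hi
        by_cases hii : i = i1
        · subst hii
          have := NWc i j hP hi
          omega
        · have h3 := (hrow i j hP hi).resolve_left hii
          subst h3
          have := hUabove i hP
          rw [hgt i (by omega), hgt (i+1) (by omega)]
          omega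
      by_cases hSW : ∃ z w, S.P z w ∧ S.i < z ∧ w < S.j
      · obtain ⟨z, w, hz, hz1, hz2⟩ := hSW
        have e1 := SWn z w hz hz1 hz2
        refine h.glue hS n hn hN _ _ hh r0 jL S.j (by omega) (by omega) (by omega) (by omega) hU ?_ ?_
        · intro i j hP hi
          refine Or.inl ⟨?_, le_rfl, le_rfl⟩
          rcases lt_trichotomy j S.j with h5 | h5 | h5
          · exact SWc i j hP hi h5
          · subst h5; exact (hDn i hP hi).elim
          · have := SEn i j hP hi h5; omega
        · intro j hP
          have := hL' j hP
          have := hR' j hP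
          omega
      · push Not at hSW
        refine h.glue hS n hn hN _ _ hh r1 jL S.j (by omega) (by omega) (by omega) (by omega) hU ?_ ?_
        · intro i j hP hi
          exact Or.inr ⟨hSW i j hP hi, le_rfl, le_rfl⟩
        · intro j hP
          have := hL' j hP
          rw [hgt S.i (by omega)]
          omega
  · push Not at hUb
    have hrow1 : ∀ a b, S.P a b → a < S.i → a = i1 := by
      intro a b h1 h2
      rcases hrow a b h1 h2 with h3 | rfl
      · exact h3
      · have := hUabove a h1
        by_contra hc
        have := hUb a h1 (by omega)
        omega
    by_cases hlow : ∃ z w, S.P z w ∧ S.i < z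
    · exfalso
      obtain ⟨z, w, hz, hz1⟩ := hlow
      refine hbad (Or.inr (Or.inr ⟨i1, hx0.1, hx0.2.1, ?_⟩))
      intro a b h1 h2
      obtain rfl := hrow1 a b h1 h2
      refine Or.inl ⟨rfl, ?_⟩
      by_contra hc
      rcases lt_trichotomy w S.j with h5 | h5 | h5
      · have h6 := SWc z w hz hz1 h5
        rcases lt_or_ge b S.j with h7 | h7
        · exact hS.n231 _ _ _ _ _ _ h1 hS.e hz h2 hz1 (by omega) (by omega)
        · exact hS.n231 _ _ _ _ _ _ h1 hR hz h2 hz1 (by omega) (by omega)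
      · subst h5; exact hDn z hz hz1
      · have h6 := SEc z w hz hz1 h5
        rcases le_or_gt b S.j with h7 | h7
        · exact hS.n213 _ _ _ _ _ _ h1 hL hz h2 hz1 (by omega) (by omega)
        · exact hS.n213 _ _ _ _ _ _ h1 hS.e hz h2 hz1 (by omega) (by omega)
    · push Not at hlow
      refine tworow hS h n hn hN i1 hxi hx0.1 ?_
      intro a b hP
      have h1 := hlow a b hP
      rcases h1.lt_or_eq with h2 | h2
      · exact Or.inl (hrow1 a b hP h2)
      · exact Or.inr h2

def flip (S : Sys) : Sys where
  P := fun a b => S.P (-1 - a) b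
  M := fun a b => S.M (-1 - a) b
  p0 := - S.p1
  p1 := - S.p0
  c0 := S.c0
  c1 := S.c1
  x0 := - S.x1
  x1 := - S.x0
  y0 := S.y0
  y1 := S.y1
  i := -1 - S.i
  j := S.j
  r := -1 - S.r

theorem cut_flip {p0 p1 x0 x1 : ℤ} {R : ℤ → ℤ} (h : CutOK p0 p1 x0 x1 R) :
    CutOK (-p1) (-p0) (-x1) (-x0) (fun t => - R (-t)) := by
  refine ⟨?_, ?_, ?_⟩
  · intro s t h0 h1 h2
    have := h.1 (-t) (-s) (by omega) (by omega) (by omega)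
    simp only; omega
  · have := h.2.2
    simp only [neg_neg]; omega
  · have := h.2.1
    simp only [neg_neg]; omega

theorem pat_flip {S : Sys} (h : S.Pat) : S.flip.Pat where
  e := by simpa [flip] using h.e
  rng := by
    intro i j hP
    have := h.rng _ _ hP
    simp only [flip]
    omega
  n213 := by
    intro a1 b1 a2 b2 a3 b3 h1 h2 h3 h4 h5 h6 h7
    exact h.n312 _ _ _ _ _ _ h3 h2 h1 (by omega) (by omega) h6 h7
  n231 := by
    intro a1 b1 a2 b2 a3 b3 h1 h2 h3 h4 h5 h6 h7
    exact h.n132 _ _ _ _ _ _ h3 h2 h1 (by omega) (by omega) h6 h7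
  n132 := by
    intro a1 b1 a2 b2 a3 b3 h1 h2 h3 h4 h5 h6 h7
    exact h.n231 _ _ _ _ _ _ h3 h2 h1 (by omega) (by omega) h6 h7
  n312 := by
    intro a1 b1 a2 b2 a3 b3 h1 h2 h3 h4 h5 h6 h7
    exact h.n213 _ _ _ _ _ _ h3 h2 h1 (by omega) (by omega) h6 h7

theorem hole_flip {S : Sys} {R C} (h : S.Hole R C) : S.flip.Hole (fun t => - R (-t)) C where
  row := by
    refine ⟨cut_flip h.row.1, ?_, ?_⟩
    · have := h.row.2.2
      simp only [flip]
      rw [show -(-1 - S.i) = S.i + 1 by ring]; omega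
    · have := h.row.2.1
      simp only [flip]
      rw [show -(-1 - S.i + 1) = S.i by ring]; omega
  col := h.col
  wit := by
    intro i j hP hne
    simp only [flip] at hP hne
    obtain ⟨a, b, h1, h2, h3, h4, h5⟩ := h.wit _ j hP (by omega)
    refine ⟨-1 - a, b, ?_, ?_, h3, h4, ?_⟩
    · rw [show -1 - i + 1 = -i by ring] at h2; omega
    · rw [show -(i+1) = -1 - i by ring]; omega
    · simpa [flip] using h5

theorem cont_flip {S : Sys} (h : S.flip.Cont) : S.Cont := by
  obtain ⟨R, C, hR, hC, hw⟩ := h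
  have := cut_flip hR
  simp only [flip, neg_neg] at this
  refine ⟨_, C, this, hC, ?_⟩
  intro i j hP
  obtain ⟨a, b, h1, h2, h3, h4, h5⟩ := hw (-1 - i) j (by simpa [flip] using hP)
  refine ⟨-1 - a, b, ?_, ?_, h3, h4, h5⟩
  · rw [show -1 - i + 1 = -i by ring] at h2; omega
  · rw [show -(i+1) = -1 - i by ring]; omega

theorem core {S : Sys} (hS : S.Pat) {N R C q} (h : S.Chain N R C q) (n : ℕ)
    (hn : S.c1 - S.c0 = n) (hN : N = n * (n+2) + 2) : S.Cont := by
  classical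
  have hex : ((Finset.Ico S.c0 S.c1).filter (fun j => S.P S.i j)).Nonempty := by
    refine ⟨S.j, ?_⟩
    have := hS.rng _ _ hS.e
    simp [hS.e, this]
  obtain ⟨jL, hL, hL'⟩ := Finset.exists_min_image _ (fun x => x) hex
  obtain ⟨jR, hR, hR'⟩ := Finset.exists_max_image _ (fun x => x) hex
  simp only [Finset.mem_filter, Finset.mem_Ico, and_imp] at hL hL' hR hR'
  have hL2 : ∀ j, S.P S.i j → jL ≤ j := fun j hP =>
    hL' j (hS.rng _ _ hP).2.2.1 (hS.rng _ _ hP).2.2.2 hP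
  have hR2 : ∀ j, S.P S.i j → j ≤ jR := fun j hP =>
    hR' j (hS.rng _ _ hP).2.2.1 (hS.rng _ _ hP).2.2.2 hP
  by_cases hg1 : S.Good (fun i => i < S.i) jL jR
  swap
  · exact bad hS h n hn hN jL jR hL.2 hL2 hR.2 hR2 hg1
  by_cases hg2 : S.Good (fun i => S.i < i) jL jR
  swap
  · apply cont_flip
    have hc : S.flip.Chain N (fun k t => - R k (-t)) C q :=
      ⟨fun k hk => hole_flip (h.hole k hk), fun k hk => by simpa [flip] using h.gap k hk⟩
    refine bad (pat_flip hS) hc n hn hN jL jR (by simpa [flip] using hL.2)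
      (by simpa [flip] using hL2) (by simpa [flip] using hR.2) (by simpa [flip] using hR2) ?_
    intro hG
    apply hg2
    rcases hG with hG | hG | ⟨x, h0, h1, hG⟩
    · refine Or.inl fun i j hP hi => hG (-1 - i) j (by simpa [flip] using hP) ?_
      simp only [flip]; omega
    · refine Or.inr (Or.inl fun i j hP hi => hG (-1 - i) j (by simpa [flip] using hP) ?_)
      simp only [flip]; omega
    · simp only [flip] at h0 h1
      refine Or.inr (Or.inr ⟨-1 - x, by omega, by omega, fun i j hP hi => ?_⟩)
      have := hG (-1 - i) j (by simpa [flip] using hP) (by simp only [flip]; omega)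
      omega
  have r0 := (h.hole 0 (by omega)).row
  have r1 := (h.hole (N-1) (by omega)).row
  obtain ⟨up, hup, hU⟩ := good_side hg1 r0 r1
  obtain ⟨lo, hlo, hD⟩ := good_side hg2 r0 r1
  exact h.glue hS n hn hN up lo hup hlo jL jR hL.1.1 (hL2 _ hS.e) (hR2 _ hS.e) hR.1.2 hU hD
    (fun j hP => Or.inl ⟨hL2 j hP, hR2 j hP⟩)

end Sys
namespace SB

def Inc (m n : ℕ) (R : ℕ → ℕ) : Prop := R 0 = 0 ∧ R m = n ∧ ∀ t < m, R t < R (t+1)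

theorem Inc.lt {m n R} (h : Inc m n R) {s t : ℕ} (hst : s < t) (ht : t ≤ m) : R s < R t := by
  induction t with
  | zero => omega
  | succ t ih =>
    have := h.2.2 t (by omega)
    rcases Nat.lt_or_ge s t with h1 | h1
    · have := ih h1 (by omega); omega
    · have : s = t := by omega
      subst this; assumption

theorem Inc.le {m n R} (h : Inc m n R) {s t : ℕ} (hst : s ≤ t) (ht : t ≤ m) : R s ≤ R t := by
  rcases Nat.lt_or_ge s t with h1 | h1
  · exact (h.lt h1 ht).le
  · have : s = t := by omega
    subst this; rfl

def Grid (P M : BMat) : Prop := ∃ R C : ℕ → ℕ, Inc P.m M.m R ∧ Inc P.n M.n C ∧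
  ∀ i j, i < P.m → j < P.n → P.entry i j = true →
    ∃ a b, R i ≤ a ∧ a < R (i+1) ∧ C j ≤ b ∧ b < C (j+1) ∧ M.entry a b = true

/-- merging back one contraction in a cut sequence -/
theorem inc_up {m n R} (h : Inc m n R) (r : ℕ) (hr : r < n) :
    Inc m (n+1) (fun t => if R t ≤ r then R t else R t + 1) := by
  refine ⟨by simp [h.1], ?_, ?_⟩
  · simp only [h.2.1]; split <;> omega
  · intro t ht
    have := h.2.2 t ht
    dsimp only
    split <;> split <;> omega

theorem rowcon_grid {P M M' : BMat} (hc : RowCon M M') (h : Grid P M') : Grid P M := by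
  obtain ⟨r, hr, hm, hn, he⟩ := hc
  obtain ⟨R, C, hR, hC, hw⟩ := h
  refine ⟨_, C, hm ▸ inc_up hR r (by omega), hn ▸ hC, ?_⟩
  intro i j hi hj hP
  obtain ⟨a, b, h1, h2, h3, h4, h5⟩ := hw i j hi hj hP
  have ha : a < M'.m := by have := hR.le (show i+1 ≤ P.m by omega) le_rfl; have := hR.2.1; omega
  have hb : b < M'.n := by have := hC.le (show j+1 ≤ P.n by omega) le_rfl; have := hC.2.1; omega
  rw [he a b ha hb] at h5
  split_ifs at h5 with c1 c2
  · exact ⟨a, b, by split <;> omega, by split <;> omega, h3, h4, h5⟩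
  · rw [Bool.or_eq_true] at h5
    rcases h5 with h5 | h5
    · exact ⟨r, b, by split <;> omega, by split <;> omega, h3, h4, h5⟩
    · exact ⟨r+1, b, by split <;> omega, by split <;> omega, h3, h4, h5⟩
  · exact ⟨a+1, b, by split <;> omega, by split <;> omega, h3, h4, h5⟩

theorem colcon_grid {P M M' : BMat} (hc : ColCon M M') (h : Grid P M') : Grid P M := by
  obtain ⟨r, hr, hm, hn, he⟩ := hc
  obtain ⟨R, C, hR, hC, hw⟩ := h
  refine ⟨R, _, hn ▸ hR, hm ▸ inc_up hC r (by omega), ?_⟩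
  intro i j hi hj hP
  obtain ⟨a, b, h1, h2, h3, h4, h5⟩ := hw i j hi hj hP
  have ha : a < M'.m := by have := hR.le (show i+1 ≤ P.m by omega) le_rfl; have := hR.2.1; omega
  have hb : b < M'.n := by have := hC.le (show j+1 ≤ P.n by omega) le_rfl; have := hC.2.1; omega
  rw [he a b ha hb] at h5
  split_ifs at h5 with c1 c2
  · exact ⟨a, b, h1, h2, by split <;> omega, by split <;> omega, h5⟩
  · rw [Bool.or_eq_true] at h5
    rcases h5 with h5 | h5
    · exact ⟨a, r, h1, h2, by split <;> omega, by split <;> omega, h5⟩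
    · exact ⟨a, r+1, h1, h2, by split <;> omega, by split <;> omega, h5⟩
  · exact ⟨a, b+1, h1, h2, by split <;> omega, by split <;> omega, h5⟩

theorem grid_of_minor {P M : BMat} (h : IntervalMinor P M) : Grid P M := by
  obtain ⟨M', hs, hm, hn, he⟩ := h
  induction hs using Relation.ReflTransGen.head_induction_on with
  | refl =>
    refine ⟨id, id, ⟨rfl, hm.symm, fun t _ => by simp⟩, ⟨rfl, hn.symm, fun t _ => by simp⟩, ?_⟩
    intro i j hi hj hP
    exact ⟨i, j, by simp, by simp, by simp, by simp, he i j hi hj hP⟩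
  | head hc _ ih =>
    rcases hc with hc | hc
    · exact rowcon_grid hc ih
    · exact colcon_grid hc ih

theorem inc_gap {m n R} (h : Inc m n R) (hmn : m ≠ n) : m < n ∧ ∃ t < m, R t + 1 < R (t+1) := by
  by_contra hcon
  have key : (∀ t < m, R (t+1) = R t + 1) → m = n := by
    intro hk
    have : ∀ t ≤ m, R t = t := by
      intro t
      induction t with
      | zero => intro _; exact h.1
      | succ t ih => intro ht; rw [hk t (by omega), ih (by omega)]
    rw [← h.2.1, this m le_rfl]
  have hle : ∀ t ≤ m, t ≤ R t := by
    intro t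
    induction t with
    | zero => intro _; omega
    | succ t ih => intro ht; have := ih (by omega); have := h.2.2 t (by omega); omega
  have h1 := hle m le_rfl
  rw [h.2.1] at h1
  apply hmn; apply key
  intro t ht
  have := h.2.2 t ht
  by_contra h2
  exact hcon ⟨by omega, t, ht, by omega⟩

theorem inc_id {m R} (h : Inc m m R) : ∀ t ≤ m, R t = t := by
  have hle : ∀ t ≤ m, t ≤ R t := by
    intro t
    induction t with
    | zero => intro _; omega
    | succ t ih => intro ht; have := ih (by omega); have := h.2.2 t (by omega); omega
  have hge : ∀ s ≤ m, R (m - s) + s ≤ m := by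
    intro s
    induction s with
    | zero => intro _; have := h.2.1; simp; omega
    | succ s ih =>
      intro hs; have := ih (by omega); have := h.2.2 (m - (s+1)) (by omega)
      rw [show m - (s+1) + 1 = m - s by omega] at this; omega
  intro t ht
  have := hle t ht
  have := hge (m - t) (by omega)
  rw [show m - (m - t) = t by omega] at this; omega

theorem inc_down {m n R} (h : Inc m n R) {t : ℕ} (ht : t < m) (hg : R t + 1 < R (t+1)) :
    Inc m (n-1) (fun s => if s ≤ t then R s else R s - 1) := by
  refine ⟨by simp [h.1], ?_, ?_⟩
  · simp only [h.2.1]; split <;> omega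
  · intro s hs
    have := h.2.2 s hs
    dsimp only
    rcases Nat.lt_trichotomy s t with h1 | h1 | h1
    · rw [if_pos (by omega), if_pos (by omega)]; exact this
    · subst h1; rw [if_pos (by omega), if_neg (by omega)]; omega
    · have := h.le (show t + 1 ≤ s by omega) (by omega)
      rw [if_neg (by omega), if_neg (by omega)]; omega

def rcon (M : BMat) (r : ℕ) : BMat := ⟨M.m - 1, M.n, fun i j =>
        if i < r then M.entry i j
        else if i = r then (M.entry r j || M.entry (r + 1) j)
        else M.entry (i + 1) j⟩

def ccon (M : BMat) (c : ℕ) : BMat := ⟨M.m, M.n - 1, fun i j =>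
        if j < c then M.entry i j
        else if j = c then (M.entry i c || M.entry i (c + 1))
        else M.entry i (j + 1)⟩

theorem minor_step {P M M' : BMat} (hc : Con M M') (h : IntervalMinor P M') :
    IntervalMinor P M := by
  obtain ⟨M'', hs, h⟩ := h
  exact ⟨M'', hs.head hc, h⟩

theorem loc {R : ℕ → ℕ} {m n : ℕ} (h : Inc m n R) {t i a : ℕ} (ht : t < m) (hi : i < m)
    (hg : R t + 1 < R (t+1)) (h1 : R i ≤ a) (h2 : a < R (i+1)) :
    (if i ≤ t then R i else R i - 1) ≤ (if a ≤ R t then a else a - 1) ∧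
    (if a ≤ R t then a else a - 1) < (if i + 1 ≤ t then R (i+1) else R (i+1) - 1) := by
  rcases Nat.lt_trichotomy i t with h3 | h3 | h3
  · have := h.le (show i+1 ≤ t by omega) (by omega)
    rw [if_pos (by omega), if_pos (by omega), if_pos (by omega)]; omega
  · subst h3
    rw [if_pos (le_refl i), if_neg (by omega : ¬ i + 1 ≤ i)]; split <;> omega
  · have := h.le (show t+1 ≤ i by omega) (by omega)
    rw [if_neg (by omega), if_neg (by omega), if_neg (by omega)]; omega

theorem minor_of_grid {P : BMat} : ∀ (k : ℕ) (M : BMat), M.m + M.n = k → Grid P M →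
    IntervalMinor P M := by
  intro k
  induction k with
  | zero =>
    intro M hk h
    obtain ⟨R, C, hR, hC, hw⟩ := h
    have hm : P.m = M.m := by by_contra hc; have := inc_gap hR hc; omega
    have hn : P.n = M.n := by by_contra hc; have := inc_gap hC hc; omega
    exact ⟨M, .refl, hm.symm, hn.symm, fun i j hi => by omega⟩
  | succ k ih =>
    intro M hk h
    obtain ⟨R, C, hR, hC, hw⟩ := h
    by_cases hm : P.m = M.m
    · by_cases hn : P.n = M.n
      · refine ⟨M, .refl, hm.symm, hn.symm, ?_⟩
        intro i j hi hj hP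
        obtain ⟨a, b, h1, h2, h3, h4, h5⟩ := hw i j hi hj hP
        rw [← hm] at hR
        rw [← hn] at hC
        have e1 := inc_id hR i (by omega)
        have e2 := inc_id hR (i+1) (by omega)
        have e3 := inc_id hC j (by omega)
        have e4 := inc_id hC (j+1) (by omega)
        rwa [show i = a by omega, show j = b by omega]
      · obtain ⟨hlt, t, ht, hg⟩ := inc_gap hC hn
        have hend := hC.le (show t+1 ≤ P.n by omega) le_rfl
        rw [hC.2.1] at hend
        refine minor_step (M' := ccon M (C t)) (Or.inr ⟨C t, by omega, ?_, rfl, ?_⟩) (ih _ ?_ ?_)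
        · simp only [ccon]; omega
        · intro i j _ _; rfl
        · simp only [ccon]; omega
        · refine ⟨R, _, hR, inc_down hC ht hg, ?_⟩
          intro i j hi hj hP
          obtain ⟨a, b, h1, h2, h3, h4, h5⟩ := hw i j hi hj hP
          obtain ⟨l1, l2⟩ := loc hC ht hj hg h3 h4
          refine ⟨a, _, h1, h2, l1, l2, ?_⟩
          simp only [ccon]
          rcases Nat.lt_trichotomy b (C t) with hb | hb | hb
          · rw [if_pos (by omega : b ≤ C t), if_pos hb]; exact h5
          · subst hb; simp [h5]
          · rw [if_neg (by omega : ¬ b ≤ C t), if_neg (by omega)]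
            split_ifs with hh
            · rw [show C t + 1 = b by omega, h5]; simp
            · rw [show b - 1 + 1 = b by omega]; exact h5
    · obtain ⟨hlt, t, ht, hg⟩ := inc_gap hR hm
      have hend := hR.le (show t+1 ≤ P.m by omega) le_rfl
      rw [hR.2.1] at hend
      refine minor_step (M' := rcon M (R t)) (Or.inl ⟨R t, by omega, ?_, rfl, ?_⟩) (ih _ ?_ ?_)
      · simp only [rcon]; omega
      · intro i j _ _; rfl
      · simp only [rcon]; omega
      · refine ⟨_, C, inc_down hR ht hg, hC, ?_⟩
        intro i j hi hj hP
        obtain ⟨a, b, h1, h2, h3, h4, h5⟩ := hw i j hi hj hP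
        obtain ⟨l1, l2⟩ := loc hR ht hi hg h1 h2
        refine ⟨_, b, l1, l2, h3, h4, ?_⟩
        simp only [rcon]
        rcases Nat.lt_trichotomy a (R t) with hb | hb | hb
        · rw [if_pos (by omega : a ≤ R t), if_pos hb]; exact h5
        · subst hb; simp [h5]
        · rw [if_neg (by omega : ¬ a ≤ R t), if_neg (by omega)]
          split_ifs with hh
          · rw [show R t + 1 = a by omega, h5]; simp
          · rw [show a - 1 + 1 = a by omega]; exact h5

/-- from loose cuts to exact cuts -/
theorem tight {m n : ℕ} {R : ℕ → ℕ} (hm : 0 < m) (hs : ∀ t < m, R t < R (t+1)) (he : R m ≤ n) :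
    Inc m n (fun t => if t = 0 then 0 else if t = m then n else R t) ∧
    ∀ t < m, (if t = 0 then 0 else if t = m then n else R t) ≤ R t ∧
      R (t+1) ≤ (if t + 1 = 0 then 0 else if t + 1 = m then n else R (t+1)) := by
  have h0 : ∀ t ≤ m, t ≤ R t := by
    intro t
    induction t with
    | zero => intro _; omega
    | succ t ih => intro ht; have := ih (by omega); have := hs t (by omega); omega
  refine ⟨⟨by simp, by simp; omega, ?_⟩, ?_⟩
  · intro t ht
    have := hs t ht
    have := h0 m le_rfl
    dsimp only
    rw [if_neg (by omega : ¬ t + 1 = 0), if_neg (by omega : ¬ t = m)]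
    by_cases c : t + 1 = m
    · rw [if_pos c]; subst c; split <;> omega
    · rw [if_neg c]; split <;> omega
  · intro t ht
    rw [if_neg (by omega : ¬ t + 1 = 0), if_neg (by omega : ¬ t = m)]
    refine ⟨by split <;> omega, ?_⟩
    by_cases c : t + 1 = m
    · rw [if_pos c]; subst c; exact he
    · rw [if_neg c]

theorem minor_of_loose {P M : BMat} (hm : 0 < P.m) (hn : 0 < P.n) (R C : ℕ → ℕ)
    (hR : ∀ t < P.m, R t < R (t+1)) (hR' : R P.m ≤ M.m)
    (hC : ∀ t < P.n, C t < C (t+1)) (hC' : C P.n ≤ M.n)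
    (hw : ∀ i j, i < P.m → j < P.n → P.entry i j = true →
      ∃ a b, R i ≤ a ∧ a < R (i+1) ∧ C j ≤ b ∧ b < C (j+1) ∧ M.entry a b = true) :
    IntervalMinor P M := by
  obtain ⟨i1, l1⟩ := tight hm hR hR'
  obtain ⟨i2, l2⟩ := tight hn hC hC'
  refine minor_of_grid _ M rfl ⟨_, _, i1, i2, ?_⟩
  intro i j hi hj hP
  obtain ⟨a, b, h1, h2, h3, h4, h5⟩ := hw i j hi hj hP
  have := l1 i hi
  have := l2 j hj
  exact ⟨a, b, by omega, by omega, by omega,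
    by omega, h5⟩

/-- three 1-entries forming the permutation Q give Q as a minor -/
theorem minor3 {Q P : BMat} (hQm : Q.m = 3) (hQn : Q.n = 3) (f : ℕ → ℕ) (a b : ℕ → ℕ)
    (hQ : ∀ i j, i < 3 → j < 3 → Q.entry i j = true → j = f i)
    (ha : a 0 < a 1 ∧ a 1 < a 2 ∧ a 2 < P.m) (hb : b 0 < b 1 ∧ b 1 < b 2 ∧ b 2 < P.n)
    (hP : ∀ i < 3, P.entry (a i) (b (f i)) = true) : IntervalMinor Q P := by
  refine minor_of_loose (by omega) (by omega) (fun t => if t = 3 then P.m else a t)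
    (fun t => if t = 3 then P.n else b t) ?_ ?_ ?_ ?_ ?_
  · intro t ht; rw [hQm] at ht; interval_cases t <;> simp <;> omega
  · rw [hQm]; simp
  · intro t ht; rw [hQn] at ht; interval_cases t <;> simp <;> omega
  · rw [hQn]; simp
  · intro i j hi hj hq
    rw [hQm] at hi
    rw [hQn] at hj
    have := hQ i j hi hj hq
    subst this
    refine ⟨a i, b (f i), ?_, ?_, ?_, ?_, hP i hi⟩
    · rw [if_neg (by omega)]
    · interval_cases i <;> simp <;> omega
    · rw [if_neg (by omega)]
    · generalize f i = j at hj; interval_cases j <;> simp <;> omega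

end SB

namespace SB

structure Hol (P M : BMat) (r z i j : ℕ) (R C : ℕ → ℕ) : Prop where
  hi : i < P.m
  hj : j < P.n
  hP : P.entry i j = true
  hR : Inc P.m M.m R
  hC : Inc P.n M.n C
  r1 : R i ≤ r
  r2 : r < R (i+1)
  z1 : C j ≤ z
  z2 : z < C (j+1)
  no : ∀ a b, R i ≤ a → a < R (i+1) → C j ≤ b → b < C (j+1) → M.entry a b ≠ true
  wit : ∀ i' j', i' < P.m → j' < P.n → P.entry i' j' = true → ¬ (i' = i ∧ j' = j) →
    ∃ a b, R i' ≤ a ∧ a < R (i'+1) ∧ C j' ≤ b ∧ b < C (j'+1) ∧ M.entry a b = true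

theorem inc_inj {m n R} (h : Inc m n R) {i i' a : ℕ} (hi : i < m) (hi' : i' < m)
    (h1 : R i ≤ a) (h2 : a < R (i+1)) (h3 : R i' ≤ a) (h4 : a < R (i'+1)) : i = i' := by
  rcases Nat.lt_trichotomy i i' with c | c | c
  · have := h.le (show i+1 ≤ i' by omega) (by omega); omega
  · exact c
  · have := h.le (show i'+1 ≤ i by omega) (by omega); omega

theorem exists_hol {P M : BMat} {r z : ℕ} (hP : ¬ Grid P M) (hG : Grid P (setOne M r z)) :
    ∃ i j R C, Hol P M r z i j R C := by
  obtain ⟨R, C, hR, hC, hw⟩ := hG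
  have hR' : Inc P.m M.m R := hR
  have hC' : Inc P.n M.n C := hC
  have : ∃ i j, i < P.m ∧ j < P.n ∧ P.entry i j = true ∧
      ∀ a b, R i ≤ a → a < R (i+1) → C j ≤ b → b < C (j+1) → M.entry a b ≠ true := by
    by_contra hcon
    apply hP
    refine ⟨R, C, hR', hC', ?_⟩
    intro i j hi hj hp
    by_contra hc
    exact hcon ⟨i, j, hi, hj, hp, fun a b h1 h2 h3 h4 h5 => hc ⟨a, b, h1, h2, h3, h4, h5⟩⟩
  obtain ⟨i, j, hi, hj, hp, hno⟩ := this
  have key : R i ≤ r ∧ r < R (i+1) ∧ C j ≤ z ∧ z < C (j+1) := by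
    obtain ⟨a, b, h1, h2, h3, h4, h5⟩ := hw i j hi hj hp
    simp only [setOne] at h5
    split_ifs at h5 with c
    · obtain ⟨rfl, rfl⟩ := c; exact ⟨h1, h2, h3, h4⟩
    · exact absurd h5 (hno a b h1 h2 h3 h4)
  obtain ⟨k1, k2, k3, k4⟩ := key
  refine ⟨i, j, R, C, hi, hj, hp, hR', hC', k1, k2, k3, k4, hno, ?_⟩
  intro i' j' hi' hj' hp' hne
  obtain ⟨a, b, h1, h2, h3, h4, h5⟩ := hw i' j' hi' hj' hp'
  refine ⟨a, b, h1, h2, h3, h4, ?_⟩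
  simp only [setOne] at h5
  split_ifs at h5 with c
  · obtain ⟨rfl, rfl⟩ := c
    exact absurd ⟨inc_inj hR' hi' hi h1 h2 k1 k2, inc_inj hC' hj' hj h3 h4 k3 k4⟩ hne
  · exact h5

/-- the integer system attached to a pattern, a matrix, an entry and a row -/
def sysOf (P M : BMat) (i j r : ℕ) : Sys where
  P := fun a b => ∃ x y : ℕ, a = x ∧ b = y ∧ x < P.m ∧ y < P.n ∧ P.entry x y = true
  M := fun a b => ∃ x y : ℕ, a = x ∧ b = y ∧ M.entry x y = true
  p0 := 0
  p1 := P.m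
  c0 := 0
  c1 := P.n
  x0 := 0
  x1 := M.m
  y0 := 0
  y1 := M.n
  i := i
  j := j
  r := r

def lift (R : ℕ → ℕ) : ℤ → ℤ := fun t => (R t.toNat : ℤ)

theorem lift_nat (R : ℕ → ℕ) (t : ℕ) : lift R t = R t := by simp [lift]

theorem lift_succ (R : ℕ → ℕ) (t : ℕ) : lift R (t + 1) = R (t + 1) := by
  have := lift_nat R (t+1)
  push_cast at this; exact this

theorem lift_cut {m n R} (h : Inc m n R) : CutOK 0 m 0 n (lift R) := by
  refine ⟨?_, ?_, ?_⟩
  · intro s t h0 h1 h2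
    have := h.lt (show s.toNat < t.toNat by omega) (by omega)
    simp only [lift]; exact_mod_cast this
  · simp [lift]
  · rw [lift_nat, h.2.1]

theorem hol_hole {P M : BMat} {r z i j : ℕ} {R C : ℕ → ℕ} (h : Hol P M r z i j R C) :
    (sysOf P M i j r).Hole (lift R) (lift C) where
  row := ⟨lift_cut h.hR, by
      have := h.r1
      simp only [sysOf, lift_nat]; exact_mod_cast this, by
      have := h.r2
      simp only [sysOf, lift_succ]; exact_mod_cast this⟩
  col := lift_cut h.hC
  wit := by
    rintro _ _ ⟨x, y, rfl, rfl, hx, hy, hp⟩ hne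
    simp only [sysOf] at hne
    obtain ⟨a, b, h1, h2, h3, h4, h5⟩ := h.wit x y hx hy hp (by
      rintro ⟨rfl, rfl⟩; exact hne ⟨rfl, rfl⟩)
    refine ⟨a, b, ?_, ?_, ?_, ?_, a, b, rfl, rfl, h5⟩
    · rw [lift_nat]; exact_mod_cast h1
    · rw [lift_succ]; exact_mod_cast h2
    · rw [lift_nat]; exact_mod_cast h3
    · rw [lift_succ]; exact_mod_cast h4

theorem tri {Q P : BMat} (hQ : Avoids Q P) (hQm : Q.m = 3) (hQn : Q.n = 3) (f : ℕ → ℕ)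
    (hQf : ∀ i j, i < 3 → j < 3 → Q.entry i j = true → j = f i)
    (a b : ℕ → ℕ)
    (ha : a 0 < a 1 ∧ a 1 < a 2 ∧ a 2 < P.m) (hb : b 0 < b 1 ∧ b 1 < b 2 ∧ b 2 < P.n)
    (hP : ∀ i < 3, P.entry (a i) (b (f i)) = true) : False :=
  hQ (minor3 hQm hQn f a b hQf ha hb hP)

def tr (x y z : ℕ) : ℕ → ℕ
  | 0 => x
  | 1 => y
  | _ => z

theorem sys_pat {P : BMat} (M : BMat) (i j r : ℕ)
    (h1 : Avoids Q1 P) (h2 : Avoids Q2 P) (h3 : Avoids Q3 P) (h4 : Avoids Q4 P)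
    (hi : i < P.m) (hj : j < P.n) (hp : P.entry i j = true) : (sysOf P M i j r).Pat where
  e := ⟨i, j, rfl, rfl, hi, hj, hp⟩
  rng := by
    rintro _ _ ⟨x, y, rfl, rfl, hx, hy, -⟩
    simp only [sysOf]; omega
  n213 := by
    rintro _ _ _ _ _ _ ⟨x1, y1, rfl, rfl, _, _, e1⟩ ⟨x2, y2, rfl, rfl, _, _, e2⟩
      ⟨x3, y3, rfl, rfl, _, _, e3⟩ _ _ _ _
    refine tri h1 rfl rfl (tr 1 0 2) ?_ (tr x1 x2 x3) (tr y2 y1 y3) ?_ ?_ ?_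
    · intro a b ha hb; interval_cases a <;> interval_cases b <;> simp [Q1, tr]
    · simp only [tr]; omega
    · simp only [tr]; omega
    · intro a ha; interval_cases a <;> simpa [tr]
  n231 := by
    rintro _ _ _ _ _ _ ⟨x1, y1, rfl, rfl, _, _, e1⟩ ⟨x2, y2, rfl, rfl, _, _, e2⟩
      ⟨x3, y3, rfl, rfl, _, _, e3⟩ _ _ _ _
    refine tri h2 rfl rfl (tr 1 2 0) ?_ (tr x1 x2 x3) (tr y3 y1 y2) ?_ ?_ ?_
    · intro a b ha hb; interval_cases a <;> interval_cases b <;> simp [Q2, tr]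
    · simp only [tr]; omega
    · simp only [tr]; omega
    · intro a ha; interval_cases a <;> simpa [tr]
  n132 := by
    rintro _ _ _ _ _ _ ⟨x1, y1, rfl, rfl, _, _, e1⟩ ⟨x2, y2, rfl, rfl, _, _, e2⟩
      ⟨x3, y3, rfl, rfl, _, _, e3⟩ _ _ _ _
    refine tri h3 rfl rfl (tr 0 2 1) ?_ (tr x1 x2 x3) (tr y1 y3 y2) ?_ ?_ ?_
    · intro a b ha hb; interval_cases a <;> interval_cases b <;> simp [Q3, tr]
    · simp only [tr]; omega
    · simp only [tr]; omega
    · intro a ha; interval_cases a <;> simpa [tr]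
  n312 := by
    rintro _ _ _ _ _ _ ⟨x1, y1, rfl, rfl, _, _, e1⟩ ⟨x2, y2, rfl, rfl, _, _, e2⟩
      ⟨x3, y3, rfl, rfl, _, _, e3⟩ _ _ _ _
    refine tri h4 rfl rfl (tr 2 0 1) ?_ (tr x1 x2 x3) (tr y2 y3 y1) ?_ ?_ ?_
    · intro a b ha hb; interval_cases a <;> interval_cases b <;> simp [Q4, tr]
    · simp only [tr]; omega
    · simp only [tr]; omega
    · intro a ha; interval_cases a <;> simpa [tr]

theorem cut_nonneg {m n : ℕ} {R : ℤ → ℤ} (h : CutOK 0 m 0 n R) (t : ℕ) (ht : t ≤ m) :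
    0 ≤ R t := by
  have := Sys.cut_le h (s := 0) (t := t) le_rfl (by omega) (by omega)
  have := h.2.1
  omega

theorem cont_minor {P M : BMat} {i j r : ℕ} (hm : 0 < P.m) (hn : 0 < P.n)
    (h : (sysOf P M i j r).Cont) : IntervalMinor P M := by
  obtain ⟨R, C, hR, hC, hw⟩ := h
  have hR' : CutOK 0 P.m 0 M.m R := hR
  have hC' : CutOK 0 P.n 0 M.n C := hC
  refine minor_of_loose hm hn (fun t => (R t).toNat) (fun t => (C t).toNat) ?_ ?_ ?_ ?_ ?_
  · intro t ht
    have := hR'.1 t ((t+1 : ℕ) : ℤ) (by omega) (by omega) (by omega)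
    have := cut_nonneg hR' t (by omega)
    omega
  · have := hR'.2.2; omega
  · intro t ht
    have := hC'.1 t ((t+1 : ℕ) : ℤ) (by omega) (by omega) (by omega)
    have := cut_nonneg hC' t (by omega)
    omega
  · have := hC'.2.2; omega
  · intro x y hx hy hp
    obtain ⟨_, _, k1, k2, k3, k4, a, b, rfl, rfl, k5⟩ := hw x y ⟨x, y, rfl, rfl, hx, hy, hp⟩
    refine ⟨a, b, ?_, ?_, ?_, ?_, k5⟩
    · omega
    · push_cast; omega
    · omega
    · push_cast; omega

theorem main (P : BMat)
    (h1 : Avoids Q1 P) (h2 : Avoids Q2 P) (h3 : Avoids Q3 P) (h4 : Avoids Q4 P) :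
    RowBounded (Av P) := by
  classical
  set N := P.n * (P.n + 2) + 2 with hN
  refine ⟨P.m * P.n * N, ?_⟩
  intro M hM r hr
  by_contra hbig
  obtain ⟨hav, hcrit⟩ := hM
  have hav' : ¬ IntervalMinor P M := hav
  have hng : ¬ Grid P M := fun h => hav' (minor_of_grid _ M rfl h)
  set S : Finset ℕ := (Finset.range M.n).filter
    (fun j => M.entry r j = false ∧ (j = 0 ∨ M.entry r (j - 1) = true)) with hS
  have hcard : P.m * P.n * N < S.card := by
    have : rowRunCount M r = S.card := by
      rw [rowRunCount, ← Set.ncard_coe_finset]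
      congr 1
      ext j
      simp [hS]
    omega
  have hex : ∀ z ∈ S, ∃ i j R C, Hol P M r z i j R C := by
    intro z hz
    rw [hS, Finset.mem_filter, Finset.mem_range] at hz
    have := hcrit r z hr hz.1 hz.2.1
    have hmin : IntervalMinor P (setOne M r z) := by
      by_contra hc; exact this hc
    exact exists_hol hng (grid_of_minor hmin)
  choose! I J R C hH using hex
  obtain ⟨⟨i, j⟩, hij, hfib⟩ := Finset.exists_lt_card_fiber_of_mul_lt_card_of_maps_to
    (s := S) (t := Finset.range P.m ×ˢ Finset.range P.n) (f := fun z => (I z, J z)) (n := N)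
    (by
      intro z hz
      have := hH z hz
      simp [this.hi, this.hj])
    (by simpa using hcard)
  set T := S.filter (fun z => (I z, J z) = (i, j)) with hT
  let z : ℕ → ℕ := fun k => if h : k < T.card then T.orderEmbOfFin rfl ⟨k, h⟩ else 0
  have hzT : ∀ k < T.card, z k ∈ T := by
    intro k hk
    simp only [z, dif_pos hk]
    exact Finset.orderEmbOfFin_mem _ _ _
  have hzlt : ∀ k, k + 1 < T.card → z k < z (k+1) := by
    intro k hk
    simp only [z, dif_pos hk, dif_pos (show k < T.card by omega)]
    simp
  have hhol : ∀ k < N, Hol P M r (z k) i j (R (z k)) (C (z k)) := by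
    intro k hk
    have hm := hzT k (by omega)
    rw [hT, Finset.mem_filter] at hm
    have := hH _ hm.1
    have he := hm.2
    simp only [Prod.mk.injEq] at he
    rw [he.1, he.2] at this
    exact this
  have hstart : ∀ k < N, M.entry r (z k) = false ∧ (z k = 0 ∨ M.entry r (z k - 1) = true) := by
    intro k hk
    have hm := hzT k (by omega)
    rw [hT, Finset.mem_filter, hS, Finset.mem_filter] at hm
    exact hm.1.2
  have h0 := hhol 0 (by omega)
  have hpat := sys_pat M i j r h1 h2 h3 h4 h0.hi h0.hj h0.hP
  have hchain : (sysOf P M i j r).Chain N (fun k => lift (R (z k))) (fun k => lift (C (z k)))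
      (fun k => ((z (k+1) - 1 : ℕ) : ℤ)) := by
    refine ⟨fun k hk => hol_hole (hhol k hk), ?_⟩
    intro k hk
    have hz := hzlt k (by omega)
    have hA := hhol k (by omega)
    have hB := hhol (k+1) hk
    have hone : M.entry r (z (k+1) - 1) = true := by
      rcases (hstart (k+1) hk).2 with h | h
      · omega
      · exact h
    have hzero := (hstart k (by omega)).1
    have hne : z k ≠ z (k+1) - 1 := by
      intro h; rw [h, hone] at hzero; exact absurd hzero (by simp)
    have hA' := hA.no r (z (k+1) - 1) hA.r1 hA.r2
    have hB' := hB.no r (z (k+1) - 1) hB.r1 hB.r2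
    have a1 := hA.z1
    have b2 := hB.z2
    refine ⟨?_, ?_, r, z (k+1) - 1, rfl, rfl, hone⟩
    · simp only [sysOf, lift_succ]
      by_contra hc
      exact hA' (by omega) (by omega) hone
    · simp only [sysOf, lift_nat]
      by_contra hc
      exact hB' (by omega) (by omega) hone
  have hcont := Sys.core hpat hchain P.n (by simp [sysOf]) hN
  exact hav' (cont_minor (by have := h0.hi; omega) (by have := h0.hj; omega) hcont)

end SB

/-- **Theorem.** Every pattern avoiding `Q₁, Q₂, Q₃, Q₄` as interval minors
is row-bounding, i.e. `Av(P)` is row-bounded. -/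
theorem stmt_4 (P : BMat)
    (h1 : Avoids Q1 P) (h2 : Avoids Q2 P) (h3 : Avoids Q3 P) (h4 : Avoids Q4 P) :
    RowBounded (Av P) := by
  exact SB.main P h1 h2 h3 h4
end

section
/- For binary matrices P ∈ {0,1}^{k×ℓ} and M ∈ {0,1}^{m×n}, the following four properties are equivalent: (1) P is an interval minor of M; (2) M has a partition containing P; (3) there exists an embedding of P into M; (4) there exists a partial embedding of P into M. -/
open BMat

theorem aux_mono (k : ℕ) (r : ℕ → ℕ) (hr : ∀ i, i < k → r i < r (i + 1)) :
    ∀ i j, i ≤ j → j ≤ k → r i + (j - i) ≤ r j := by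
  intro i j hij
  induction j, hij using Nat.le_induction with
  | base => intro _; omega
  | succ j hij ih =>
    intro hj
    have := ih (by omega)
    have := hr j (by omega)
    omega

theorem aux_split (k m : ℕ) (r : ℕ → ℕ) (hk : 1 ≤ k) (hkm : k < m)
    (hr : ∀ i, i < k → r i < r (i + 1)) (hrm : r k ≤ m) :
    ∃ (s : ℕ) (r' : ℕ → ℕ), s + 1 < m ∧ (∀ i, i < k → r' i < r' (i + 1)) ∧ r' k + 1 ≤ m ∧
      ∀ i a, i < k → r i ≤ a → a < r (i + 1) →
        r' i ≤ (if a ≤ s then a else a - 1) ∧ (if a ≤ s then a else a - 1) < r' (i + 1) := by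
  -- normalise
  obtain ⟨q, hq, hq0, hqk, hqr⟩ : ∃ q : ℕ → ℕ, (∀ i, i < k → q i < q (i + 1)) ∧ q 0 = 0 ∧
      q k = m ∧ ∀ i, i < k → q i ≤ r i ∧ r (i + 1) ≤ q (i + 1) := by
    obtain ⟨q, e0, ek, e⟩ : ∃ q : ℕ → ℕ, q 0 = 0 ∧ q k = m ∧ ∀ i, 0 < i → i < k → q i = r i := by
      refine ⟨fun i => if i = 0 then 0 else if i = k then m else r i, if_pos rfl, ?_, ?_⟩
      · dsimp only
        rw [if_neg (by omega), if_pos rfl]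
      · intro i h1 h2
        dsimp only
        rw [if_neg (by omega), if_neg (by omega)]
    have hlo : ∀ i, i < k → q i ≤ r i := by
      intro i hi
      rcases Nat.eq_zero_or_pos i with h | h
      · subst h; omega
      · exact (e i h hi).le
    have hhi : ∀ i, i < k → r (i + 1) ≤ q (i + 1) := by
      intro i hi
      by_cases h : i + 1 = k
      · rw [h]; omega
      · exact (e (i + 1) (by omega) (by omega)).ge
    refine ⟨q, ?_, e0, ek, fun i hi => ⟨hlo i hi, hhi i hi⟩⟩
    intro i hi
    have := hr i hi
    have := hlo i hi
    have := hhi i hi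
    omega
  obtain ⟨i, hi, hi2⟩ : ∃ i, i < k ∧ q i + 2 ≤ q (i + 1) := by
    by_contra hcon
    push Not at hcon
    have : ∀ j, j ≤ k → q j = j := by
      intro j
      induction j with
      | zero => intro _; exact hq0
      | succ j ih =>
        intro hj
        have := ih (by omega)
        have := hcon j (by omega)
        have := hq j (by omega)
        omega
    have := this k le_rfl
    omega
  have hm := aux_mono k q hq
  refine ⟨q i, fun j => if j ≤ i then q j else q j - 1, ?_, ?_, ?_, ?_⟩
  · have := hm (i + 1) k (by omega) le_rfl
    omega
  · intro j hj
    have := hq j hj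
    dsimp only
    by_cases h : j = i
    · subst h
      split_ifs <;> omega
    · have h5 : i < j → q j ≥ 1 := by
        intro h6
        have := hm i j (by omega) (by omega)
        omega
      by_cases h6 : j < i
      · rw [if_pos (by omega), if_pos (by omega)]; omega
      · rw [if_neg (by omega), if_neg (by omega)]
        have := h5 (by omega)
        omega
  · dsimp only
    split_ifs <;> omega
  · intro j a hj h1 h2
    have h3 := hqr j hj
    dsimp only
    by_cases h : j = i
    · subst h
      split_ifs <;> omega
    · rcases Nat.lt_or_gt_of_ne h with h | h
      · have := hm (j + 1) i (by omega) (by omega)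
        split_ifs <;> omega
      · have := hm (i + 1) j (by omega) (by omega)
        split_ifs <;> omega

theorem aux_lift (k m s : ℕ) (r : ℕ → ℕ) (hr : ∀ i, i < k → r i < r (i + 1)) (hrm : r k ≤ m) :
    ∃ r' : ℕ → ℕ, (∀ i, i < k → r' i < r' (i + 1)) ∧ r' k ≤ m + 1 ∧
      ∀ i a, i < k → r i ≤ a → a < r (i + 1) →
        (a ≤ s → r' i ≤ a ∧ a < r' (i + 1)) ∧
        (s ≤ a → r' i ≤ a + 1 ∧ a + 1 < r' (i + 1)) := by
  refine ⟨fun i => if r i ≤ s then r i else r i + 1, ?_, ?_, ?_⟩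
  · intro i hi
    have := hr i hi
    dsimp only
    split_ifs <;> omega
  · dsimp only
    split_ifs <;> omega
  · intro i a hi h1 h2
    dsimp only
    split_ifs <;> omega

theorem aux_bound (k m : ℕ) (r : ℕ → ℕ) (hr : ∀ i, i < k → r i < r (i + 1)) (hrm : r k ≤ m)
    (i : ℕ) (hi : i < k) : r (i + 1) ≤ m := by
  have := aux_mono k r hr (i + 1) k (by omega) le_rfl
  omega

theorem con_back (P M M' : BMat) (h : Con M M') (hp : PartitionContains M' P) :
    PartitionContains M P := by
  obtain ⟨r, c, hr, hc, hrm, hcm, hw⟩ := hp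
  rcases h with ⟨s, hs, hm, hn, he⟩ | ⟨s, hs, hn, hm, he⟩
  · obtain ⟨r', h1, h2, h3⟩ := aux_lift P.m M'.m s r hr hrm
    refine ⟨r', c, h1, hc, by omega, by omega, ?_⟩
    intro i j hi hj hP
    obtain ⟨a, b, ha1, ha2, hb1, hb2, hab⟩ := hw i j hi hj hP
    have hba := aux_bound _ _ r hr hrm i hi
    have hbb := aux_bound _ _ c hc hcm j hj
    rw [he a b (by omega) (by omega)] at hab
    have h4 := h3 i a hi ha1 ha2
    split_ifs at hab with g1 g2
    · exact ⟨a, b, (h4.1 (by omega)).1, (h4.1 (by omega)).2, hb1, hb2, hab⟩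
    · subst g2
      rcases (Bool.or_eq_true _ _).mp hab with hab | hab
      · exact ⟨a, b, (h4.1 (by omega)).1, (h4.1 (by omega)).2, hb1, hb2, hab⟩
      · exact ⟨a + 1, b, (h4.2 (by omega)).1, (h4.2 (by omega)).2, hb1, hb2, hab⟩
    · exact ⟨a + 1, b, (h4.2 (by omega)).1, (h4.2 (by omega)).2, hb1, hb2, hab⟩
  · obtain ⟨c', h1, h2, h3⟩ := aux_lift P.n M'.n s c hc hcm
    refine ⟨r, c', hr, h1, by omega, by omega, ?_⟩
    intro i j hi hj hP
    obtain ⟨a, b, ha1, ha2, hb1, hb2, hab⟩ := hw i j hi hj hP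
    have hba := aux_bound _ _ r hr hrm i hi
    have hbb := aux_bound _ _ c hc hcm j hj
    rw [he a b (by omega) (by omega)] at hab
    have h4 := h3 j b hj hb1 hb2
    split_ifs at hab with g1 g2
    · exact ⟨a, b, ha1, ha2, (h4.1 (by omega)).1, (h4.1 (by omega)).2, hab⟩
    · subst g2
      rcases (Bool.or_eq_true _ _).mp hab with hab | hab
      · exact ⟨a, b, ha1, ha2, (h4.1 (by omega)).1, (h4.1 (by omega)).2, hab⟩
      · exact ⟨a, b + 1, ha1, ha2, (h4.2 (by omega)).1, (h4.2 (by omega)).2, hab⟩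
    · exact ⟨a, b + 1, ha1, ha2, (h4.2 (by omega)).1, (h4.2 (by omega)).2, hab⟩

theorem one_two (P M : BMat) (h : IntervalMinor P M) : PartitionContains M P := by
  obtain ⟨M', hM, hm, hn, he⟩ := h
  induction hM using Relation.ReflTransGen.head_induction_on with
  | refl =>
    exact ⟨id, id, fun i _ => Nat.lt_succ_self i, fun i _ => Nat.lt_succ_self i, by simp [hm],
      by simp [hn], fun i j hi hj hP => ⟨i, j, le_rfl, Nat.lt_succ_self i, le_rfl,
        Nat.lt_succ_self j, he i j hi hj hP⟩⟩
  | head h _ ih => exact con_back _ _ _ h ih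

theorem two_one (P : BMat) (hPm : 1 ≤ P.m) (hPn : 1 ≤ P.n) :
    ∀ (t : ℕ) (M : BMat), M.m + M.n = t → PartitionContains M P → IntervalMinor P M := by
  intro t
  induction t with
  | zero =>
    rintro M hM ⟨r, c, hr, hc, hrm, hcm, hw⟩
    have := aux_mono _ r hr 0 P.m (by omega) le_rfl
    omega
  | succ t ih =>
    rintro M hM ⟨r, c, hr, hc, hrm, hcm, hw⟩
    have hr0 := aux_mono _ r hr
    have hc0 := aux_mono _ c hc
    have hr1 := hr0 0 P.m (by omega) le_rfl
    have hc1 := hc0 0 P.n (by omega) le_rfl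
    by_cases h1 : P.m < M.m
    · obtain ⟨s, r', hs, hr', hrm', h2⟩ := aux_split P.m M.m r hPm h1 hr hrm
      let M' : BMat := ⟨M.m - 1, M.n, fun i j =>
        if i < s then M.entry i j
        else if i = s then (M.entry s j || M.entry (s + 1) j)
        else M.entry (i + 1) j⟩
      have hcon : Con M M' := Or.inl ⟨s, hs, by dsimp only [M']; omega, rfl, fun i j _ _ => rfl⟩
      have hpc : PartitionContains M' P := by
        refine ⟨r', c, hr', hc, by dsimp only [M']; omega, hcm, ?_⟩
        intro i j hi hj hP
        obtain ⟨a, b, ha1, ha2, hb1, hb2, hab⟩ := hw i j hi hj hP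
        have h3 := h2 i a hi ha1 ha2
        refine ⟨_, b, h3.1, h3.2, hb1, hb2, ?_⟩
        dsimp only [M']
        rcases lt_trichotomy a s with g | g | g
        · simp [g, g.le, hab]
        · subst g; simp [hab]
        · obtain ⟨d, rfl⟩ : ∃ d, a = d + 1 := ⟨a - 1, by omega⟩
          rw [if_neg (by omega : ¬ d + 1 ≤ s), Nat.add_sub_cancel, if_neg (by omega : ¬ d < s)]
          split_ifs with g2
          · subst g2; simp [hab]
          · exact hab
      obtain ⟨N, hN, h⟩ := ih M' (by dsimp only [M']; omega) hpc
      exact ⟨N, Relation.ReflTransGen.head hcon hN, h⟩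
    by_cases h1' : P.n < M.n
    · obtain ⟨s, c', hs, hc', hcm', h2⟩ := aux_split P.n M.n c hPn h1' hc hcm
      let M' : BMat := ⟨M.m, M.n - 1, fun i j =>
        if j < s then M.entry i j
        else if j = s then (M.entry i s || M.entry i (s + 1))
        else M.entry i (j + 1)⟩
      have hcon : Con M M' := Or.inr ⟨s, hs, by dsimp only [M']; omega, rfl, fun i j _ _ => rfl⟩
      have hpc : PartitionContains M' P := by
        refine ⟨r, c', hr, hc', hrm, by dsimp only [M']; omega, ?_⟩
        intro i j hi hj hP
        obtain ⟨a, b, ha1, ha2, hb1, hb2, hab⟩ := hw i j hi hj hP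
        have h3 := h2 j b hj hb1 hb2
        refine ⟨a, _, ha1, ha2, h3.1, h3.2, ?_⟩
        dsimp only [M']
        rcases lt_trichotomy b s with g | g | g
        · simp [g, g.le, hab]
        · subst g; simp [hab]
        · obtain ⟨d, rfl⟩ : ∃ d, b = d + 1 := ⟨b - 1, by omega⟩
          rw [if_neg (by omega : ¬ d + 1 ≤ s), Nat.add_sub_cancel, if_neg (by omega : ¬ d < s)]
          split_ifs with g2
          · subst g2; simp [hab]
          · exact hab
      obtain ⟨N, hN, h⟩ := ih M' (by dsimp only [M']; omega) hpc
      exact ⟨N, Relation.ReflTransGen.head hcon hN, h⟩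
    refine ⟨M, Relation.ReflTransGen.refl, by omega, by omega, ?_⟩
    intro i j hi hj hP
    obtain ⟨a, b, ha1, ha2, hb1, hb2, hab⟩ := hw i j hi hj hP
    have e1 := hr0 0 i (by omega) (by omega)
    have e2 := hr0 (i + 1) P.m (by omega) le_rfl
    have e3 := hc0 0 j (by omega) (by omega)
    have e4 := hc0 (j + 1) P.n (by omega) le_rfl
    obtain rfl : a = i := by omega
    obtain rfl : b = j := by omega
    exact hab

theorem two_three (P M : BMat) (h : PartitionContains M P) : ∃ φ, IsEmbedding P M φ := by
  obtain ⟨r, c, hr, hc, hrm, hcm, hw⟩ := h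
  have hr0 := aux_mono _ r hr
  have hc0 := aux_mono _ c hc
  have key : ∀ i j, ∃ p : ℕ × ℕ, i < P.m → j < P.n →
      (r i ≤ p.1 ∧ p.1 < r (i + 1) ∧ c j ≤ p.2 ∧ p.2 < c (j + 1) ∧
      (P.entry i j = true → M.entry p.1 p.2 = true)) := by
    intro i j
    by_cases hi : i < P.m
    · by_cases hj : j < P.n
      · by_cases hP : P.entry i j = true
        · obtain ⟨a, b, h1, h2, h3, h4, h5⟩ := hw i j hi hj hP
          exact ⟨(a, b), fun _ _ => ⟨h1, h2, h3, h4, fun _ => h5⟩⟩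
        · exact ⟨(r i, c j), fun _ _ => ⟨le_rfl, hr i hi, le_rfl, hc j hj, fun h => absurd h hP⟩⟩
      · exact ⟨(0, 0), fun _ h => absurd h hj⟩
    · exact ⟨(0, 0), fun h => absurd h hi⟩
  choose φ hφ using key
  refine ⟨φ, ?_, ?_, ?_⟩
  · intro i j hi hj
    have := hφ i j hi hj
    have := aux_bound _ _ r hr hrm i hi
    have := aux_bound _ _ c hc hcm j hj
    omega
  · intro i j hi hj hP
    exact (hφ i j hi hj).2.2.2.2 hP
  · intro i₁ j₁ i₂ j₂ hi₁ hj₁ hi₂ hj₂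
    have h1 := hφ i₁ j₁ hi₁ hj₁
    have h2 := hφ i₂ j₂ hi₂ hj₂
    constructor
    · intro h
      have := hr0 (i₁ + 1) i₂ (by omega) (by omega)
      omega
    · intro h
      have := hc0 (j₁ + 1) j₂ (by omega) (by omega)
      omega

theorem aux_gap (k l m : ℕ) (f : ℕ → ℕ → ℕ)
    (hb : ∀ i j, i < k → j < l → f i j < m)
    (hf : ∀ i₁ j₁ i₂ j₂, i₁ < k → j₁ < l → i₂ < k → j₂ < l → i₁ < i₂ → f i₁ j₁ < f i₂ j₂) :
    (∀ i j, i < k → j < l → i ≤ f i j ∧ f i j + (k - 1 - i) ≤ m - 1) ∧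
    ∀ i₁ j₁ i₂ j₂, i₁ < k → j₁ < l → i₂ < k → j₂ < l → i₁ < i₂ →
      f i₁ j₁ + (i₂ - i₁) ≤ f i₂ j₂ := by
  have h2 : ∀ i₁ j₁ i₂, i₁ < i₂ → ∀ j₂, i₁ < k → j₁ < l → i₂ < k → j₂ < l →
      f i₁ j₁ + (i₂ - i₁) ≤ f i₂ j₂ := by
    intro i₁ j₁ i₂ h
    induction i₂, h using Nat.le_induction with
    | base =>
      intro j₂ a b c d
      have := hf i₁ j₁ (i₁ + 1) j₂ a b c d (by omega)
      simp only [Nat.succ_eq_add_one] at *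
      omega
    | succ n hn ih =>
      intro j₂ a b c d
      have := ih j₂ a b (by omega) d
      have := hf n j₂ (n + 1) j₂ (by omega) d c d (by omega)
      omega
  refine ⟨?_, fun i₁ j₁ i₂ j₂ a b c d e => h2 i₁ j₁ i₂ e j₂ a b c d⟩
  intro i j hi hj
  constructor
  · rcases Nat.eq_zero_or_pos i with h | h
    · omega
    · have := h2 0 j i h j (by omega) hj hi hj
      omega
  · by_cases h : i < k - 1
    · have := h2 i j (k - 1) h j (by omega) hj (by omega) hj
      have := hb (k - 1) j (by omega) hj
      omega
    · have := hb i j hi hj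
      omega

theorem three_four (P M : BMat) (hPm : 1 ≤ P.m) (hPn : 1 ≤ P.n)
    (h : ∃ φ, IsEmbedding P M φ) : ∃ S ψ, IsPartialEmbedding P M S ψ := by
  obtain ⟨φ, h1, h2, h3⟩ := h
  have hR := aux_gap P.m P.n M.m (fun i j => (φ i j).1) (fun i j a b => (h1 i j a b).1)
    (fun i₁ j₁ i₂ j₂ a b c d e => (h3 i₁ j₁ i₂ j₂ a b c d).1 e)
  have hC := aux_gap P.n P.m M.n (fun j i => (φ i j).2) (fun j i a b => (h1 i j b a).2)
    (fun j₁ i₁ j₂ i₂ a b c d e => (h3 i₁ j₁ i₂ j₂ b a d c).2 e)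
  refine ⟨{e | e.1 < P.m ∧ e.2 < P.n}, fun e => φ e.1 e.2, ⟨(0, 0), by
    simp only [Set.mem_setOf_eq]; omega⟩, fun e he => he,
    fun i j hi hj hP => ⟨⟨hi, hj⟩, h2 i j hi hj hP⟩, ?_, ?_⟩
  · rintro ⟨i, j⟩ ⟨hi, hj⟩
    dsimp only at hi hj ⊢
    have := h1 i j hi hj
    have := hR.1 i j hi hj
    have := hC.1 j i hj hi
    omega
  · rintro ⟨i₁, j₁⟩ ⟨hi₁, hj₁⟩ ⟨i₂, j₂⟩ ⟨hi₂, hj₂⟩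
    dsimp only at hi₁ hj₁ hi₂ hj₂ ⊢
    constructor
    · intro h
      have := hR.2 i₁ j₁ i₂ j₂ hi₁ hj₁ hi₂ hj₂ h
      omega
    · intro h
      have := hC.2 j₁ i₁ j₂ i₂ hj₁ hi₁ hj₂ hi₂ h
      omega

theorem aux_part (k m : ℕ) (hk : 1 ≤ k) (T : Set (ℕ × ℕ)) (hT : T.Nonempty)
    (h1 : ∀ p ∈ T, p.1 < k ∧ p.2 < m ∧ p.1 ≤ p.2 ∧ k - 1 - p.1 ≤ m - 1 - p.2)
    (h2 : ∀ p ∈ T, ∀ q ∈ T, p.1 < q.1 → q.1 - p.1 ≤ q.2 - p.2) :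
    ∃ r : ℕ → ℕ, (∀ i, i < k → r i < r (i + 1)) ∧ r k ≤ m ∧
      ∀ p ∈ T, r p.1 ≤ p.2 ∧ p.2 < r (p.1 + 1) := by
  let A : ℕ → Set ℕ := fun i => insert i {x | ∃ p ∈ T, p.1 < i ∧ x = p.2 + (i - p.1)}
  have hA : ∀ i, (A i).Nonempty := fun i => ⟨i, Set.mem_insert _ _⟩
  have hB : ∀ i, BddAbove (A i) := by
    intro i
    refine ⟨m + i, ?_⟩
    rintro x (rfl | ⟨p, hp, hpi, rfl⟩)
    · omega
    · have := h1 p hp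
      omega
  have hle : ∀ i b, (∀ x ∈ A i, x ≤ b) → sSup (A i) ≤ b := fun i b h => csSup_le (hA i) h
  have hge : ∀ i x, x ∈ A i → x ≤ sSup (A i) := fun i x h => le_csSup (hB i) h
  refine ⟨fun i => sSup (A i), ?_, ?_, ?_⟩
  · intro i hi
    have hmem := Nat.sSup_mem (hA i) (hB i)
    dsimp only
    apply Nat.lt_of_succ_le
    apply hge
    rcases hmem with h | ⟨p, hp, hpi, h⟩
    · rw [h]; exact Set.mem_insert _ _
    · exact Or.inr ⟨p, hp, by omega, by omega⟩
  · apply hle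
    obtain ⟨p0, hp0⟩ := hT
    have := h1 p0 hp0
    rintro x (rfl | ⟨p, hp, hpi, rfl⟩)
    · omega
    · have := h1 p hp
      omega
  · intro p hp
    have hp1 := h1 p hp
    constructor
    · apply hle
      rintro x (rfl | ⟨q, hq, hqi, rfl⟩)
      · omega
      · have := h2 q hq p hp hqi
        omega
    · apply Nat.lt_of_succ_le
      apply hge
      exact Or.inr ⟨p, hp, by omega, by omega⟩

theorem four_two (P M : BMat) (hPm : 1 ≤ P.m) (hPn : 1 ≤ P.n)
    (h : ∃ S ψ, IsPartialEmbedding P M S ψ) : PartitionContains M P := by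
  obtain ⟨S, ψ, hne, hS, he, hb, hg⟩ := h
  obtain ⟨r, hr, hrm, hrw⟩ := aux_part P.m M.m hPm ((fun e => (e.1, (ψ e).1)) '' S)
    (hne.image _)
    (by
      rintro _ ⟨e, hes, rfl⟩
      have := hS e hes
      have := hb e hes
      dsimp only
      omega)
    (by
      rintro _ ⟨e, hes, rfl⟩ _ ⟨e', hes', rfl⟩
      exact (hg e hes e' hes').1)
  obtain ⟨c, hc, hcm, hcw⟩ := aux_part P.n M.n hPn ((fun e => (e.2, (ψ e).2)) '' S)
    (hne.image _)
    (by
      rintro _ ⟨e, hes, rfl⟩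
      have := hS e hes
      have := hb e hes
      dsimp only
      omega)
    (by
      rintro _ ⟨e, hes, rfl⟩ _ ⟨e', hes', rfl⟩
      exact (hg e hes e' hes').2)
  refine ⟨r, c, hr, hc, hrm, hcm, ?_⟩
  intro i j hi hj hP
  obtain ⟨hs, hM⟩ := he i j hi hj hP
  have a1 := hrw _ ⟨_, hs, rfl⟩
  have a2 := hcw _ ⟨_, hs, rfl⟩
  exact ⟨_, _, a1.1, a1.2, a2.1, a2.2, hM⟩

/-- **Lemma.** For (nonempty) binary matrices `P` and `M`, the following are
equivalent: `P` is an interval minor of `M`; `M` has a partition containing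
`P`; there is an embedding of `P` into `M`; there is a partial embedding of
`P` into `M`. -/
theorem stmt_5 (P M : BMat)
    (hPm : 1 ≤ P.m) (hPn : 1 ≤ P.n) (hMm : 1 ≤ M.m) (hMn : 1 ≤ M.n) :
    List.TFAE [IntervalMinor P M, PartitionContains M P,
      ∃ φ, IsEmbedding P M φ, ∃ S ψ, IsPartialEmbedding P M S ψ] := by
  tfae_have 1 → 2 := one_two P M
  tfae_have 2 → 1 := two_one P hPm hPn _ M rfl
  tfae_have 2 → 3 := two_three P M
  tfae_have 3 → 4 := three_four P M hPm hPn
  tfae_have 4 → 2 := four_two P M hPm hPn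
  tfae_finish
end

section
/- A binary matrix M ∈ {0,1}^{m×n} avoids the diagonal pattern D_k as an interval minor if and only if there exist k−1 increasing walks W₁, …, W_{k−1}, each from the position (m,1) to the position (1,n), such that supp(M) ⊆ W₁ ∪ W₂ ∪ ⋯ ∪ W_{k−1}. -/
open BMat

namespace BMat

/-- Chains of length `k` in a set of positions. -/
def HasChain (S : Set (ℕ × ℕ)) (k : ℕ) : Prop :=
  ∃ a : ℕ → ℕ × ℕ, (∀ i, i < k → a i ∈ S) ∧
    ∀ i, i + 1 < k → (a i).1 < (a (i + 1)).1 ∧ (a i).2 < (a (i + 1)).2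

lemma chain_lt {a : ℕ → ℕ × ℕ} {k : ℕ}
    (h : ∀ i, i + 1 < k → (a i).1 < (a (i + 1)).1 ∧ (a i).2 < (a (i + 1)).2)
    (i j : ℕ) (hij : i < j) (hj : j < k) : (a i).1 < (a j).1 ∧ (a i).2 < (a j).2 := by
  induction j with
  | zero => omega
  | succ j ih =>
    have h1 := h j hj
    rcases Nat.lt_succ_iff_lt_or_eq.mp hij with h2 | h2
    · have := ih h2 (by omega)
      omega
    · subst h2; exact h1

lemma chain_of_con {M M' : BMat} (h : Con M M') (k : ℕ) (hc : HasChain M'.supp k) :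
    HasChain M.supp k := by
  obtain ⟨a, ha, hlt⟩ := hc
  simp only [supp, Set.mem_ofPred_eq] at ha
  rcases h with ⟨r, hr, hm, hn, he⟩ | ⟨r, hr, hn, hm, he⟩
  · refine ⟨fun i => (if (a i).1 < r then (a i).1 else if (a i).1 = r then
      (if M.entry r (a i).2 = true then r else r + 1) else (a i).1 + 1, (a i).2), ?_, ?_⟩
    · intro i hi
      obtain ⟨h1, h2, h3⟩ := ha i hi
      rw [he _ _ h1 h2] at h3
      simp only [supp, Set.mem_ofPred_eq]
      refine ⟨by split_ifs <;> omega, by omega, ?_⟩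
      split_ifs at h3 ⊢ <;> simp_all
    · intro i hi
      obtain ⟨h1, h2⟩ := hlt i hi
      refine ⟨?_, h2⟩
      dsimp only
      split_ifs <;> omega
  · refine ⟨fun i => ((a i).1, if (a i).2 < r then (a i).2 else if (a i).2 = r then
      (if M.entry (a i).1 r = true then r else r + 1) else (a i).2 + 1), ?_, ?_⟩
    · intro i hi
      obtain ⟨h1, h2, h3⟩ := ha i hi
      rw [he _ _ h1 h2] at h3
      simp only [supp, Set.mem_ofPred_eq]
      refine ⟨by omega, by split_ifs <;> omega, ?_⟩
      split_ifs at h3 ⊢ <;> simp_all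
    · intro i hi
      obtain ⟨h1, h2⟩ := hlt i hi
      refine ⟨h1, ?_⟩
      dsimp only
      split_ifs <;> omega

lemma chain_of_minor {M : BMat} {k : ℕ} (h : IntervalMinor (D k) M) : HasChain M.supp k := by
  obtain ⟨M', hr, hm, hn, he⟩ := h
  have : HasChain M'.supp k := by
    refine ⟨fun i => (i, i), ?_, fun i _ => by simp⟩
    intro i hi
    simp only [D] at hm hn
    exact ⟨by simp only; omega, by simp only; omega, he i i hi hi (by simp [D])⟩
  clear hm hn he
  induction hr with
  | refl => exact this
  | tail _ hc ih => exact ih (chain_of_con hc k this)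

lemma exists_gap (k m : ℕ) (hk : 1 ≤ k) (hkm : k < m) (f : ℕ → ℕ) :
    ∃ r, r + 1 < m ∧ ((∀ i, i < k → f i ≠ r) ∨ (∀ i, i < k → f i ≠ r + 1)) := by
  have : ∃ r ∈ Finset.range m, r ∉ (Finset.range k).image f := by
    apply Finset.exists_mem_notMem_of_card_lt_card
    calc _ ≤ (Finset.range k).card := Finset.card_image_le
      _ < _ := by simpa using hkm
  obtain ⟨r, hr, hr'⟩ := this
  simp only [Finset.mem_range, Finset.mem_image, not_exists, not_and] at hr hr'
  by_cases h : r + 1 < m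
  · exact ⟨r, h, Or.inl hr'⟩
  · refine ⟨r - 1, by omega, Or.inr fun i hi => ?_⟩
    have := hr' i hi
    omega

lemma minor_of_chain (k : ℕ) (hk : 1 ≤ k) (N : ℕ) : ∀ (M : BMat), M.m + M.n = N →
    HasChain M.supp k → IntervalMinor (D k) M := by
  induction N using Nat.strong_induction_on with
  | _ N ih =>
  intro M hN hc
  have step : ∀ M', Con M M' → HasChain M'.supp k → IntervalMinor (D k) M := by
    intro M' hcon hc'
    have hlt : M'.m + M'.n < N := by
      rcases hcon with ⟨r, h1, h2, h3, -⟩ | ⟨r, h1, h2, h3, -⟩ <;> omega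
    obtain ⟨M'', h1, h2⟩ := ih _ hlt M' rfl hc'
    exact ⟨M'', Relation.ReflTransGen.head hcon h1, h2⟩
  obtain ⟨a, ha, hlt⟩ := hc
  have hge : ∀ i, i < k → i ≤ (a i).1 ∧ i ≤ (a i).2 := by
    intro i
    induction i with
    | zero => intro _; omega
    | succ i ihi =>
      intro hi
      have := hlt i hi
      have := ihi (by omega)
      omega
  have hle : ∀ d i, i + d + 1 = k → (a i).1 + d < M.m ∧ (a i).2 + d < M.n := by
    intro d
    induction d with
    | zero => intro i hi; have := ha i (by omega); simp only [supp, Set.mem_ofPred_eq] at this; omega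
    | succ d ihd =>
      intro i hi
      have := ihd (i+1) (by omega)
      have := hlt i (by omega)
      omega
  have hk0 := hle (k-1) 0 (by omega)
  by_cases hm : k < M.m
  · obtain ⟨r, hr, hgap⟩ := exists_gap k M.m hk hm (fun i => (a i).1)
    refine step ⟨M.m - 1, M.n, fun i j => if i < r then M.entry i j
        else if i = r then (M.entry r j || M.entry (r + 1) j)
        else M.entry (i + 1) j⟩ (Or.inl ⟨r, hr, ?_, rfl, fun _ _ _ _ => rfl⟩) ?_
    · simp only; omega
    · refine ⟨fun i => (if (a i).1 ≤ r then (a i).1 else (a i).1 - 1, (a i).2), ?_, ?_⟩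
      · intro i hi
        obtain ⟨h1, h2, h3⟩ := ha i hi
        refine ⟨by show (if (a i).1 ≤ r then (a i).1 else (a i).1 - 1) < M.m - 1; split_ifs <;> omega, h2, ?_⟩
        dsimp only
        rcases lt_trichotomy (a i).1 r with h | h | h
        · simp [h, h.le, h3]
        · rw [h] at h3
          simp [h, h3]
        · rw [if_neg (show ¬ (a i).1 ≤ r by omega), if_neg (show ¬ (a i).1 - 1 < r by omega)]
          by_cases h' : (a i).1 = r + 1
          · rw [h'] at h3
            simp [h', h3]
          · rw [if_neg (by omega), show (a i).1 - 1 + 1 = (a i).1 by omega]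
            exact h3
      · intro i hi
        obtain ⟨h1, h2⟩ := hlt i hi
        refine ⟨?_, h2⟩
        dsimp only
        rcases hgap with h | h
        · have := h i (by omega)
          have := h (i+1) (by omega)
          split_ifs <;> omega
        · have := h i (by omega)
          have := h (i+1) (by omega)
          split_ifs <;> omega
  by_cases hn : k < M.n
  · obtain ⟨r, hr, hgap⟩ := exists_gap k M.n hk hn (fun i => (a i).2)
    refine step ⟨M.m, M.n - 1, fun i j => if j < r then M.entry i j
        else if j = r then (M.entry i r || M.entry i (r + 1))
        else M.entry i (j + 1)⟩ (Or.inr ⟨r, hr, ?_, rfl, fun _ _ _ _ => rfl⟩) ?_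
    · simp only; omega
    · refine ⟨fun i => ((a i).1, if (a i).2 ≤ r then (a i).2 else (a i).2 - 1), ?_, ?_⟩
      · intro i hi
        obtain ⟨h1, h2, h3⟩ := ha i hi
        refine ⟨h1, by show (if (a i).2 ≤ r then (a i).2 else (a i).2 - 1) < M.n - 1; split_ifs <;> omega, ?_⟩
        dsimp only
        rcases lt_trichotomy (a i).2 r with h | h | h
        · simp [h, h.le, h3]
        · rw [h] at h3
          simp [h, h3]
        · rw [if_neg (show ¬ (a i).2 ≤ r by omega), if_neg (show ¬ (a i).2 - 1 < r by omega)]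
          by_cases h' : (a i).2 = r + 1
          · rw [h'] at h3
            simp [h', h3]
          · rw [if_neg (by omega), show (a i).2 - 1 + 1 = (a i).2 by omega]
            exact h3
      · intro i hi
        obtain ⟨h1, h2⟩ := hlt i hi
        refine ⟨h1, ?_⟩
        dsimp only
        rcases hgap with h | h
        · have := h i (by omega)
          have := h (i+1) (by omega)
          split_ifs <;> omega
        · have := h i (by omega)
          have := h (i+1) (by omega)
          split_ifs <;> omega
  refine ⟨M, .refl, by simp only [D]; omega, by simp only [D]; omega, ?_⟩
  intro i j hi hj hij
  simp only [D, beq_iff_eq] at hi hj hij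
  subst hij
  have h1 := hge i hi
  have h2 := hle (k - 1 - i) i (by omega)
  have h3 := (ha i hi).2.2
  rwa [show (a i).1 = i by omega, show (a i).2 = i by omega] at h3

lemma walk_insert {W : Set (ℕ × ℕ)} {e e₁ e' : ℕ × ℕ} (h : IsIncreasingWalk W e₁ e')
    (hs : (e₁.1 = e.1 ∧ e₁.2 = e.2 + 1) ∨ (e₁.1 + 1 = e.1 ∧ e₁.2 = e.2)) :
    IsIncreasingWalk (insert e W) e e' := by
  obtain ⟨t, f, h0, ht, hW, hf⟩ := h
  refine ⟨t + 1, fun i => Nat.casesOn i e f, rfl, ht, ?_, ?_⟩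
  · ext x
    rw [hW]
    simp only [Set.mem_insert_iff, Set.mem_ofPred_eq]
    constructor
    · rintro (rfl | ⟨i, hi, rfl⟩)
      · exact ⟨0, by omega, rfl⟩
      · exact ⟨i + 1, by omega, rfl⟩
    · rintro ⟨_ | i, hi, rfl⟩
      · exact Or.inl rfl
      · exact Or.inr ⟨i, by omega, rfl⟩
  · rintro (_ | i) hi
    · simpa [h0] using hs
    · exact hf i (by omega)

lemma walk_anti {W : Set (ℕ × ℕ)} {e e' : ℕ × ℕ} (h : IsIncreasingWalk W e e')
    {p q : ℕ × ℕ} (hp : p ∈ W) (hq : q ∈ W) : ¬ (p.1 < q.1 ∧ p.2 < q.2) := by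
  obtain ⟨t, f, h0, ht, hW, hf⟩ := h
  have key : ∀ j, j ≤ t → ∀ i, i ≤ j → (f j).1 ≤ (f i).1 ∧ (f i).2 ≤ (f j).2 := by
    intro j
    induction j with
    | zero => intro _ i hi; simp [Nat.le_zero.mp hi]
    | succ j ih =>
      intro hj i hi
      rcases Nat.le_succ_iff.mp hi with h | h
      · have := ih (by omega) i h
        have := hf j (by omega)
        omega
      · subst h; simp
  rw [hW] at hp hq
  obtain ⟨i, hi, rfl⟩ := hp
  obtain ⟨j, hj, rfl⟩ := hq
  rcases le_total i j with h | h
  · have := key j hj i h; omega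
  · have := key i hi j h; omega

lemma walk_cover (n N : ℕ) : ∀ (a b : ℕ) (S : Set (ℕ × ℕ)), b ≤ n → a + (n - b) = N →
    (∀ p ∈ S, p.1 ≤ a ∧ b ≤ p.2 ∧ p.2 ≤ n) →
    (∀ p ∈ S, ∀ q ∈ S, ¬ (p.1 < q.1 ∧ p.2 < q.2)) →
    ∃ W, IsIncreasingWalk W (a, b) (0, n) ∧ S ⊆ W := by
  induction N with
  | zero =>
    intro a b S hb hN hS _
    obtain rfl : a = 0 := by omega
    obtain rfl : b = n := by omega
    refine ⟨{(0, b)}, ⟨0, fun _ => (0, b), rfl, rfl, ?_, fun i hi => by omega⟩, ?_⟩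
    · ext x
      simp only [Set.mem_singleton_iff, Set.mem_ofPred_eq]
      exact ⟨fun h => ⟨0, le_rfl, h.symm⟩, fun ⟨_, _, h⟩ => h.symm⟩
    · intro p hp
      have := hS p hp
      exact Prod.ext (by simp only; omega) (by simp only; omega)
  | succ N ih =>
    intro a b S hb hN hS hA
    have hA' : ∀ p ∈ S \ {(a, b)}, ∀ q ∈ S \ {(a, b)}, ¬ (p.1 < q.1 ∧ p.2 < q.2) :=
      fun p hp q hq => hA p hp.1 q hq.1
    have fin : ∀ W, S \ {(a, b)} ⊆ W → S ⊆ insert (a, b) W := by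
      intro W hW p hp
      by_cases h : p = (a, b)
      · exact Or.inl h
      · exact Or.inr (hW ⟨hp, h⟩)
    have right : b < n → (∀ p ∈ S, p.2 = b → p.1 = a) →
        ∃ W, IsIncreasingWalk W (a, b) (0, n) ∧ S ⊆ W := by
      intro hbn hcol
      obtain ⟨W, hW, hSW⟩ := ih a (b + 1) (S \ {(a, b)}) (by omega) (by omega) (by
        rintro p ⟨hp, hne⟩
        have h1 := hS p hp
        have h2 := hcol p hp
        have : p.2 ≠ b := fun h => hne (Prod.ext (h2 h) h)
        omega) hA'
      exact ⟨_, walk_insert hW (by simp), fin W hSW⟩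
    by_cases hex : ∃ q ∈ S, q.1 = a ∧ b < q.2
    · obtain ⟨q, hq, hqa, hqb⟩ := hex
      have h1 := hS q hq
      refine right (by omega) fun p hp hpb => ?_
      have h2 := hS p hp
      have h3 := hA p hp q hq
      omega
    · push Not at hex
      by_cases ha : a = 0
      · refine right (by omega) fun p hp _ => ?_
        have := hS p hp
        omega
      · obtain ⟨W, hW, hSW⟩ := ih (a - 1) b (S \ {(a, b)}) hb (by omega) (by
          rintro p ⟨hp, hne⟩
          have h1 := hS p hp
          have h2 := hex p hp
          have : p.1 ≠ a := fun h => hne (Prod.ext h (by simp only; have := h2 h; omega))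
          omega) hA'
        exact ⟨_, walk_insert hW (Or.inr ⟨by show a - 1 + 1 = a; omega, rfl⟩), fin W hSW⟩

lemma cover_of_no_chain (m n k : ℕ) : ∀ S : Set (ℕ × ℕ), (∀ p ∈ S, p.1 ≤ m ∧ p.2 ≤ n) →
    ¬ HasChain S (k + 1) →
    ∃ W : Fin k → Set (ℕ × ℕ), (∀ i, IsIncreasingWalk (W i) (m, 0) (0, n)) ∧ S ⊆ ⋃ i, W i := by
  induction k with
  | zero =>
    intro S _ hc
    refine ⟨fun i => i.elim0, fun i => i.elim0, fun p hp => ?_⟩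
    exact (hc ⟨fun _ => p, fun _ _ => hp, fun i hi => by omega⟩).elim
  | succ k ih =>
    intro S hS hc
    obtain ⟨W, hW, hTW⟩ := ih {p | p ∈ S ∧ ∃ q ∈ S, q.1 < p.1 ∧ q.2 < p.2}
      (fun p hp => hS p hp.1) (by
        rintro ⟨a, ha, hlt⟩
        obtain ⟨q, hq, hqa⟩ := (ha 0 (by omega)).2
        refine hc ⟨fun i => Nat.casesOn i q a, ?_, ?_⟩
        · rintro (_ | i) hi
          · exact hq
          · exact (ha i (by omega)).1
        · rintro (_ | i) hi
          · exact hqa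
          · exact hlt i (by omega))
    obtain ⟨W₀, hW₀, hSW₀⟩ := walk_cover n _ m 0
      {p | p ∈ S ∧ ¬ ∃ q ∈ S, q.1 < p.1 ∧ q.2 < p.2} (by omega) rfl
      (fun p hp => by have := hS p hp.1; omega)
      (fun p hp q hq h => hq.2 ⟨p, hp.1, h⟩)
    refine ⟨Fin.cons W₀ W, ?_, ?_⟩
    · intro i
      refine Fin.cases ?_ (fun i => ?_) i
      · simpa using hW₀
      · simpa using hW i
    · intro p hp
      rw [Set.mem_iUnion]
      by_cases h : ∃ q ∈ S, q.1 < p.1 ∧ q.2 < p.2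
      · obtain ⟨i, hi⟩ := Set.mem_iUnion.mp (hTW ⟨hp, h⟩)
        exact ⟨i.succ, by simpa using hi⟩
      · exact ⟨0, by simpa using hSW₀ ⟨hp, h⟩⟩

end BMat

/-- **Proposition.** A matrix `M ∈ {0,1}^{m×n}` avoids `D_k` as an interval
minor iff there are `k−1` increasing walks, each from the bottom-left
position to the top-right position, whose union covers `supp(M)`. -/
theorem stmt_6 (k : ℕ) (hk : 1 ≤ k) (M : BMat) (hm : 1 ≤ M.m) (hn : 1 ≤ M.n) :
    Avoids (D k) M ↔
      ∃ W : Fin (k - 1) → Set (ℕ × ℕ),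
        (∀ i, IsIncreasingWalk (W i) (M.m - 1, 0) (0, M.n - 1)) ∧
        M.supp ⊆ ⋃ i, W i := by
  constructor
  · intro h
    refine cover_of_no_chain (M.m - 1) (M.n - 1) (k - 1) M.supp ?_ ?_
    · rintro p ⟨h1, h2, -⟩
      omega
    · rw [Nat.sub_add_cancel hk]
      exact fun hc => h (minor_of_chain k hk _ M rfl hc)
  · rintro ⟨W, hW, hS⟩ hmin
    obtain ⟨a, ha, hlt⟩ := chain_of_minor hmin
    have hex : ∀ i : Fin k, ∃ j, a i ∈ W j := fun i => Set.mem_iUnion.mp (hS (ha i i.2))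
    choose g hg using hex
    obtain ⟨x, y, hne, hxy⟩ := Fintype.exists_ne_map_eq_of_card_lt g (by simp; omega)
    have hx := hg x
    have hy := hg y
    rw [hxy] at hx
    rcases lt_or_gt_of_ne hne with h | h
    · exact walk_anti (hW _) hx hy (chain_lt hlt x y h y.2)
    · exact walk_anti (hW _) hy hx (chain_lt hlt y x h x.2)
end

section
/- If a binary pattern P avoids all four patterns Q₁, Q₂, Q₃, Q₄ as interval minors, then at least one of the following holds: (1) P avoids D₂ as an interval minor; (2) P avoids D̄₂ as an interval minor; (3) P can be covered by three lines. -/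
open BMat


namespace S7

def freeP (x y : ℕ × ℕ) : Prop := x.1 ≠ y.1 ∧ x.2 ≠ y.2
def incP (x y : ℕ × ℕ) : Prop := (x.1 < y.1 ↔ x.2 < y.2)

theorem hall_half (E : ℕ → ℕ → Prop) (n : ℕ) (hE : ∀ i j, E i j → i < n ∧ j < n)
    (R C : Finset ℕ) (hc : ∀ i j, E i j → i ∈ R ∨ j ∈ C)
    (hmin : ∀ R' C' : Finset ℕ, (∀ i j, E i j → i ∈ R' ∨ j ∈ C') →
      R.card + C.card ≤ R'.card + C'.card) :
    ∃ f : R → ℕ, Function.Injective f ∧ ∀ r : R, E r (f r) ∧ f r ∉ C := by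
  classical
  let t : R → Finset ℕ := fun r => (Finset.range n).filter (fun j => E r j ∧ j ∉ C)
  have key : ∀ s : Finset R, s.card ≤ (s.biUnion t).card := by
    intro s
    have h := hmin (R \ s.map (Function.Embedding.subtype _)) (C ∪ s.biUnion t) ?_
    · have hsub : s.map (Function.Embedding.subtype _) ⊆ R := by
        intro x hx
        simp at hx
        exact hx.1
      have h1 := Finset.card_sdiff_add_card_eq_card hsub
      have h2 := Finset.card_union_le C (s.biUnion t)
      rw [Finset.card_map] at h1
      omega
    · intro i j hij
      rcases hc i j hij with hi | hj
      · by_cases hs : (⟨i, hi⟩ : R) ∈ s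
        · by_cases hjC : j ∈ C
          · right; simp [hjC]
          · right
            rw [Finset.mem_union]; right
            rw [Finset.mem_biUnion]
            exact ⟨_, hs, by simp [t, hij, hjC, (hE i j hij).2]⟩
        · left
          simp [hi, hs]
      · right; simp [hj]
  obtain ⟨f, hf, hft⟩ := (Finset.all_card_le_biUnion_card_iff_exists_injective t).1 key
  refine ⟨f, hf, fun r => ?_⟩
  have := hft r
  simp [t] at this
  exact this.2

theorem konig (E : ℕ → ℕ → Prop) (n : ℕ) (hE : ∀ i j, E i j → i < n ∧ j < n)
    (hno : ¬ ∃ R C : Finset ℕ, R.card + C.card ≤ 3 ∧ ∀ i j, E i j → i ∈ R ∨ j ∈ C) :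
    ∃ p : Fin 4 → ℕ × ℕ, (∀ i, E (p i).1 (p i).2) ∧ ∀ i j, i ≠ j → freeP (p i) (p j) := by
  classical
  have hex : ∃ s, ∃ R C : Finset ℕ, R.card + C.card = s ∧ ∀ i j, E i j → i ∈ R ∨ j ∈ C :=
    ⟨_, Finset.range n, ∅, rfl, fun i j h => Or.inl (by simpa using (hE i j h).1)⟩
  obtain ⟨R, C, hs, hc⟩ := Nat.find_spec hex
  have hmin : ∀ R' C' : Finset ℕ, (∀ i j, E i j → i ∈ R' ∨ j ∈ C') →
      R.card + C.card ≤ R'.card + C'.card := by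
    intro R' C' h
    rw [hs]
    exact Nat.find_min' hex ⟨R', C', rfl, h⟩
  obtain ⟨f, hf, hf'⟩ := hall_half E n hE R C hc hmin
  obtain ⟨g, hg, hg'⟩ := hall_half (fun i j => E j i) n (fun i j h => (hE j i h).symm) C R
    (fun i j h => (hc j i h).symm) (fun R' C' h => by
      have := hmin C' R' (fun i j h' => (h j i h').symm)
      omega)
  have hcard : 4 ≤ Fintype.card (R ⊕ C) := by
    simp only [Fintype.card_sum, Fintype.card_coe]
    by_contra h
    exact hno ⟨R, C, by omega, hc⟩
  obtain ⟨e⟩ : Nonempty (Fin 4 ↪ (R ⊕ C)) :=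
    Function.Embedding.nonempty_of_card_le (by simpa using hcard)
  let q : R ⊕ C → ℕ × ℕ := fun x => match x with
    | .inl r => (r, f r)
    | .inr c => (g c, c)
  have hq : ∀ x, E (q x).1 (q x).2 := by
    rintro (r | c)
    · exact (hf' r).1
    · exact (hg' c).1
  have hq2 : ∀ x y, x ≠ y → freeP (q x) (q y) := by
    rintro (r | c) (r' | c') h
    · have h' : r ≠ r' := fun h' => h (by rw [h'])
      exact ⟨fun h2 => h' (Subtype.ext h2), fun h2 => h' (hf h2)⟩
    · exact ⟨fun h2 => (hg' c').2 (by have : (r : ℕ) = g c' := h2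
                                      rw [← this]; exact r.2),
        fun h2 => (hf' r).2 (by have : f r = (c' : ℕ) := h2
                                rw [this]; exact c'.2)⟩
    · exact ⟨fun h2 => (hg' c).2 (by have : g c = (r' : ℕ) := h2
                                     rw [this]; exact r'.2),
        fun h2 => (hf' r').2 (by have : (c : ℕ) = f r' := h2
                                 rw [← this]; exact c.2)⟩
    · have h' : c ≠ c' := fun h' => h (by rw [h'])
      exact ⟨fun h2 => h' (hg h2), fun h2 => h' (Subtype.ext h2)⟩
  exact ⟨fun i => q (e i), fun i => hq _, fun i j h => hq2 _ _ (fun h' => h (e.injective h'))⟩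

theorem freeP.symm {x y : ℕ × ℕ} (h : freeP x y) : freeP y x := ⟨h.1.symm, h.2.symm⟩
theorem incP_comm {x y : ℕ × ℕ} (h : freeP x y) : incP x y ↔ incP y x := by
  unfold incP; unfold freeP at h; omega

/-- Combinatorial core: all free pairs have the same orientation. -/
theorem core (S : ℕ × ℕ → Prop)
    (T : ∀ x y z, S x → S y → S z → freeP x y → freeP x z → freeP y z →
      (incP x y ↔ incP x z))
    (p : Fin 4 → ℕ × ℕ) (hp : ∀ i, S (p i)) (hfree : ∀ i j, i ≠ j → freeP (p i) (p j))
    (a b : ℕ × ℕ) (ha : S a) (hb : S b) (hab : freeP a b) :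
    incP a b ↔ incP (p 0) (p 1) := by
  -- step 1
  have s0 : ∀ i j k, i ≠ j → i ≠ k → (incP (p i) (p j) ↔ incP (p i) (p k)) := by
    intro i j k hij hik
    by_cases hjk : j = k
    · rw [hjk]
    · exact T _ _ _ (hp _) (hp _) (hp _) (hfree _ _ hij) (hfree _ _ hik) (hfree _ _ hjk)
  have s1 : ∀ i j, i ≠ j → (incP (p i) (p j) ↔ incP (p 0) (p 1)) := by
    intro i j hij
    by_cases hi : i = 0
    · subst hi; exact s0 0 j 1 hij (by decide)
    · rw [s0 i j 0 hij hi, incP_comm (hfree _ _ hi)]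
      exact s0 0 i 1 (Ne.symm hi) (by decide)
  -- step 2
  have s2 : ∀ a, S a → ∀ i, freeP a (p i) → (incP a (p i) ↔ incP (p 0) (p 1)) := by
    intro a ha i hai
    have hex : ∃ j, j ≠ i ∧ freeP a (p j) := by
      by_contra hne
      push Not at hne
      have hch : ∀ j, j ≠ i → a.1 = (p j).1 ∨ a.2 = (p j).2 := by
        intro j hj
        have := hne j hj
        unfold freeP at this
        tauto
      have h3 : ∃ j k l : Fin 4, j ≠ i ∧ k ≠ i ∧ l ≠ i ∧ j ≠ k ∧ j ≠ l ∧ k ≠ l := by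
        clear * -
        revert i; decide
      obtain ⟨j, k, l, hj, hk, hl, hjk, hjl, hkl⟩ := h3
      have A := hch j hj
      have B := hch k hk
      have C := hch l hl
      have D1 := hfree _ _ hjk
      have D2 := hfree _ _ hjl
      have D3 := hfree _ _ hkl
      unfold freeP at D1 D2 D3
      omega
    obtain ⟨j, hji, haj⟩ := hex
    rw [incP_comm hai, T _ _ (p j) (hp i) ha (hp j) hai.symm (hfree _ _ hji.symm) haj]
    exact s1 _ _ hji.symm
  -- step 3
  by_cases hcom : ∃ i, freeP a (p i) ∧ freeP b (p i)
  · obtain ⟨i, h1, h2⟩ := hcom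
    rw [T a b (p i) ha hb (hp i) hab h1 h2]
    exact s2 a ha i h1
  · have hch : ∀ i, ∃ t : Fin 4, (t = 0 ∧ a.1 = (p i).1) ∨ (t = 1 ∧ a.2 = (p i).2) ∨
        (t = 2 ∧ b.1 = (p i).1) ∨ (t = 3 ∧ b.2 = (p i).2) := by
      intro i
      by_contra hne
      apply hcom
      refine ⟨i, ⟨fun h => hne ⟨0, ?_⟩, fun h => hne ⟨1, ?_⟩⟩,
        ⟨fun h => hne ⟨2, ?_⟩, fun h => hne ⟨3, ?_⟩⟩⟩ <;> simp [h]
    choose f hf using hch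
    have hinj : Function.Injective f := by
      intro i j hij
      by_contra hne
      have h1 := hf i
      have h2 := hf j
      have h3 := hfree i j hne
      rw [← hij] at h2
      unfold freeP at h3
      rcases h1 with ⟨e, h1⟩ | ⟨e, h1⟩ | ⟨e, h1⟩ | ⟨e, h1⟩ <;> rw [e] at h2 <;>
        simp at h2 <;> omega
    have hsur : Function.Surjective f := Finite.injective_iff_surjective.1 hinj
    obtain ⟨i, hi⟩ := hsur 0
    obtain ⟨j, hj⟩ := hsur 1
    obtain ⟨k, hk⟩ := hsur 2
    obtain ⟨l, hl⟩ := hsur 3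
    have hfi := hf i
    have hfj := hf j
    have hfk := hf k
    have hfl := hf l
    rw [hi] at hfi
    rw [hj] at hfj
    rw [hk] at hfk
    rw [hl] at hfl
    simp at hfi hfj hfk hfl
    have ne : ∀ {x y}, f x ≠ f y → x ≠ y := fun h h' => h (by rw [h'])
    have hij : i ≠ j := ne (by rw [hi, hj]; decide)
    have hik : i ≠ k := ne (by rw [hi, hk]; decide)
    have hil : i ≠ l := ne (by rw [hi, hl]; decide)
    have hjk : j ≠ k := ne (by rw [hj, hk]; decide)
    have hjl : j ≠ l := ne (by rw [hj, hl]; decide)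
    have hkl : k ≠ l := ne (by rw [hk, hl]; decide)
    have f1 := hfree _ _ hij
    have f2 := hfree _ _ hik
    have f3 := hfree _ _ hil
    have f4 := hfree _ _ hjk
    have f5 := hfree _ _ hjl
    have f6 := hfree _ _ hkl
    have g1 := s2 a ha k (by unfold freeP at *; omega)
    have g2 := s2 a ha l (by unfold freeP at *; omega)
    have g3 := s2 b hb i (by unfold freeP at *; omega)
    have g4 := s2 b hb j (by unfold freeP at *; omega)
    have e2 := s1 _ _ hik
    have e4 := s1 _ _ hjk
    have e3 := s1 _ _ hil
    have e5 := s1 _ _ hjl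
    generalize incP (p 0) (p 1) = σ at *
    unfold incP freeP at *
    clear s0 s1 s2 T hcom hf
    by_cases hσ : σ <;> simp only [hσ, iff_true, iff_false] at * <;> omega

theorem T_of_tri (S : ℕ × ℕ → Prop)
    (Tri : ∀ x y z, S x → S y → S z → x.1 < y.1 → y.1 < z.1 → x.2 ≠ y.2 → x.2 ≠ z.2 →
      y.2 ≠ z.2 → (x.2 < y.2 ∧ y.2 < z.2) ∨ (z.2 < y.2 ∧ y.2 < x.2))
    (x y z) (hx : S x) (hy : S y) (hz : S z) (hxy : freeP x y) (hxz : freeP x z)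
    (hyz : freeP y z) : incP x y ↔ incP x z := by
  unfold freeP incP at *
  rcases lt_or_gt_of_ne hxy.1 with h1 | h1 <;> rcases lt_or_gt_of_ne hxz.1 with h2 | h2 <;>
    rcases lt_or_gt_of_ne hyz.1 with h3 | h3
  · have := Tri x y z hx hy hz; omega
  · have := Tri x z y hx hz hy; omega
  · omega
  · have := Tri z x y hz hx hy; omega
  · have := Tri y x z hy hx hz; omega
  · omega
  · have := Tri y z x hy hz hx; omega
  · have := Tri z y x hz hy hx; omega

/-! ### interval minors -/

theorem con_origin {M M' : BMat} (h : Con M M') :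
    ∃ φ ψ : ℕ → ℕ, Monotone φ ∧ Monotone ψ ∧ ∀ i j, i < M'.m → j < M'.n →
      M'.entry i j = true → ∃ a b, φ a = i ∧ ψ b = j ∧ a < M.m ∧ b < M.n ∧
        M.entry a b = true := by
  rcases h with ⟨r, h1, h2, h3, h4⟩ | ⟨r, h1, h2, h3, h4⟩
  · refine ⟨fun x => if x ≤ r then x else x - 1, id, ?_, monotone_id, ?_⟩
    · intro x y hxy; dsimp only; split_ifs <;> omega
    · intro i j hi hj he
      rw [h4 i j hi hj] at he
      split_ifs at he with c1 c2
      · exact ⟨i, j, by dsimp only; split_ifs <;> omega, rfl, by omega, by omega, he⟩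
      · rw [Bool.or_eq_true] at he
        rcases he with he | he
        · exact ⟨r, j, by dsimp only; split_ifs <;> omega, rfl, by omega, by omega, he⟩
        · exact ⟨r + 1, j, by dsimp only; split_ifs <;> omega, rfl, by omega, by omega, he⟩
      · exact ⟨i + 1, j, by dsimp only; split_ifs <;> omega, rfl, by omega, by omega, he⟩
  · refine ⟨id, fun x => if x ≤ r then x else x - 1, monotone_id, ?_, ?_⟩
    · intro x y hxy; dsimp only; split_ifs <;> omega
    · intro i j hi hj he
      rw [h4 i j hi hj] at he
      split_ifs at he with c1 c2
      · exact ⟨i, j, rfl, by dsimp only; split_ifs <;> omega, by omega, by omega, he⟩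
      · rw [Bool.or_eq_true] at he
        rcases he with he | he
        · exact ⟨i, r, rfl, by dsimp only; split_ifs <;> omega, by omega, by omega, he⟩
        · exact ⟨i, r + 1, rfl, by dsimp only; split_ifs <;> omega, by omega, by omega, he⟩
      · exact ⟨i, j + 1, rfl, by dsimp only; split_ifs <;> omega, by omega, by omega, he⟩

theorem origin {M M' : BMat} (h : Relation.ReflTransGen Con M M') :
    ∃ φ ψ : ℕ → ℕ, Monotone φ ∧ Monotone ψ ∧ ∀ i j, i < M'.m → j < M'.n →
      M'.entry i j = true → ∃ a b, φ a = i ∧ ψ b = j ∧ a < M.m ∧ b < M.n ∧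
        M.entry a b = true := by
  induction h with
  | refl => exact ⟨id, id, monotone_id, monotone_id, fun i j hi hj he =>
      ⟨i, j, rfl, rfl, hi, hj, he⟩⟩
  | tail _ hc ih =>
    obtain ⟨φ, ψ, h1, h2, h3⟩ := ih
    obtain ⟨φ', ψ', h1', h2', h3'⟩ := con_origin hc
    refine ⟨φ' ∘ φ, ψ' ∘ ψ, h1'.comp h1, h2'.comp h2, ?_⟩
    intro i j hi hj he
    obtain ⟨a, b, ha, hb, ham, hbn, he'⟩ := h3' i j hi hj he
    obtain ⟨a', b', ha', hb', ham', hbn', he''⟩ := h3 a b ham hbn he'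
    exact ⟨a', b', by simp [ha', ha], by simp [hb', hb], ham', hbn', he''⟩

theorem contractRows (k : ℕ) : ∀ (M : BMat) (r0 r1 r2 : ℕ), M.m = 3 + k → r0 < r1 → r1 < r2 →
    r2 < M.m → ∃ M', Relation.ReflTransGen Con M M' ∧ M'.m = 3 ∧ M'.n = M.n ∧
      ∀ j, j < M.n → (M.entry r0 j = true → M'.entry 0 j = true) ∧
        (M.entry r1 j = true → M'.entry 1 j = true) ∧
        (M.entry r2 j = true → M'.entry 2 j = true) := by
  induction k with
  | zero =>
    intro M r0 r1 r2 hm h0 h1 h2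
    obtain rfl : r0 = 0 := by omega
    obtain rfl : r1 = 1 := by omega
    obtain rfl : r2 = 2 := by omega
    exact ⟨M, .refl, hm, rfl, fun j hj => ⟨id, id, id⟩⟩
  | succ k ih =>
    intro M r0 r1 r2 hm h0 h1 h2
    obtain ⟨r, hr, hr0, hr1⟩ : ∃ r, r + 1 < M.m ∧ ¬ (r0 = r ∧ r1 = r + 1) ∧
        ¬ (r1 = r ∧ r2 = r + 1) := by
      by_cases a0 : 0 < r0
      · exact ⟨0, by omega, by omega, by omega⟩
      by_cases a1 : r0 + 1 < r1
      · exact ⟨r0, by omega, by omega, by omega⟩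
      by_cases a2 : r1 + 1 < r2
      · exact ⟨r1, by omega, by omega, by omega⟩
      · exact ⟨r2, by omega, by omega, by omega⟩
    let N : BMat := ⟨M.m - 1, M.n, fun i j =>
        if i < r then M.entry i j
        else if i = r then (M.entry r j || M.entry (r + 1) j)
        else M.entry (i + 1) j⟩
    have hN : Con M N := Or.inl ⟨r, hr, by simp [N]; omega, rfl, fun i j _ _ => rfl⟩
    let φ : ℕ → ℕ := fun x => if x ≤ r then x else x - 1
    have hφ : ∀ x j, M.entry x j = true → N.entry (φ x) j = true := by
      intro x j hx
      simp only [N, φ]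
      by_cases c1 : x < r
      · rw [if_pos (by omega : x ≤ r), if_pos c1]; exact hx
      by_cases c2 : x = r
      · subst c2; simp [hx]
      by_cases c3 : x = r + 1
      · subst c3; simp [hx]
      · rw [if_neg (by omega : ¬ x ≤ r), if_neg (by omega : ¬ x - 1 < r),
          if_neg (by omega : ¬ x - 1 = r),
          (by omega : x - 1 + 1 = x)]
        exact hx
    obtain ⟨M', g1, g2, g3, g4⟩ := ih N (φ r0) (φ r1) (φ r2) (by simp [N]; omega)
      (by simp only [φ]; split_ifs <;> omega) (by simp only [φ]; split_ifs <;> omega)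
      (by simp only [φ, N]; split_ifs <;> omega)
    exact ⟨M', .head hN g1, g2, g3, fun j hj => ⟨fun h => (g4 j hj).1 (hφ _ _ h),
      fun h => (g4 j hj).2.1 (hφ _ _ h), fun h => (g4 j hj).2.2 (hφ _ _ h)⟩⟩

theorem contractCols (k : ℕ) : ∀ (M : BMat) (r0 r1 r2 : ℕ), M.n = 3 + k → r0 < r1 → r1 < r2 →
    r2 < M.n → ∃ M', Relation.ReflTransGen Con M M' ∧ M'.n = 3 ∧ M'.m = M.m ∧
      ∀ j, j < M.m → (M.entry j r0 = true → M'.entry j 0 = true) ∧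
        (M.entry j r1 = true → M'.entry j 1 = true) ∧
        (M.entry j r2 = true → M'.entry j 2 = true) := by
  induction k with
  | zero =>
    intro M r0 r1 r2 hm h0 h1 h2
    obtain rfl : r0 = 0 := by omega
    obtain rfl : r1 = 1 := by omega
    obtain rfl : r2 = 2 := by omega
    exact ⟨M, .refl, hm, rfl, fun j hj => ⟨id, id, id⟩⟩
  | succ k ih =>
    intro M r0 r1 r2 hm h0 h1 h2
    obtain ⟨r, hr, hr0, hr1⟩ : ∃ r, r + 1 < M.n ∧ ¬ (r0 = r ∧ r1 = r + 1) ∧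
        ¬ (r1 = r ∧ r2 = r + 1) := by
      by_cases a0 : 0 < r0
      · exact ⟨0, by omega, by omega, by omega⟩
      by_cases a1 : r0 + 1 < r1
      · exact ⟨r0, by omega, by omega, by omega⟩
      by_cases a2 : r1 + 1 < r2
      · exact ⟨r1, by omega, by omega, by omega⟩
      · exact ⟨r2, by omega, by omega, by omega⟩
    let N : BMat := ⟨M.m, M.n - 1, fun i j =>
        if j < r then M.entry i j
        else if j = r then (M.entry i r || M.entry i (r + 1))
        else M.entry i (j + 1)⟩
    have hN : Con M N := Or.inr ⟨r, hr, by simp [N]; omega, rfl, fun i j _ _ => rfl⟩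
    let φ : ℕ → ℕ := fun x => if x ≤ r then x else x - 1
    have hφ : ∀ x j, M.entry j x = true → N.entry j (φ x) = true := by
      intro x j hx
      simp only [N, φ]
      by_cases c1 : x < r
      · rw [if_pos (by omega : x ≤ r), if_pos c1]; exact hx
      by_cases c2 : x = r
      · subst c2; simp [hx]
      by_cases c3 : x = r + 1
      · subst c3; simp [hx]
      · rw [if_neg (by omega : ¬ x ≤ r), if_neg (by omega : ¬ x - 1 < r),
          if_neg (by omega : ¬ x - 1 = r),
          (by omega : x - 1 + 1 = x)]
        exact hx
    obtain ⟨M', g1, g2, g3, g4⟩ := ih N (φ r0) (φ r1) (φ r2) (by simp [N]; omega)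
      (by simp only [φ]; split_ifs <;> omega) (by simp only [φ]; split_ifs <;> omega)
      (by simp only [φ, N]; split_ifs <;> omega)
    exact ⟨M', .head hN g1, g2, g3, fun j hj => ⟨fun h => (g4 j hj).1 (hφ _ _ h),
      fun h => (g4 j hj).2.1 (hφ _ _ h), fun h => (g4 j hj).2.2 (hφ _ _ h)⟩⟩

theorem minor3 (Q M : BMat) (hQm : Q.m = 3) (hQn : Q.n = 3) (ρ γ : ℕ → ℕ)
    (h0 : ρ 0 < ρ 1) (h1 : ρ 1 < ρ 2) (h2 : ρ 2 < M.m)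
    (k0 : γ 0 < γ 1) (k1 : γ 1 < γ 2) (k2 : γ 2 < M.n)
    (hQ : ∀ i j, i < 3 → j < 3 → Q.entry i j = true → M.entry (ρ i) (γ j) = true) :
    IntervalMinor Q M := by
  obtain ⟨M1, a1, a2, a3, a4⟩ := contractRows (M.m - 3) M (ρ 0) (ρ 1) (ρ 2) (by omega) h0 h1 h2
  obtain ⟨M2, b1, b2, b3, b4⟩ := contractCols (M1.n - 3) M1 (γ 0) (γ 1) (γ 2) (by omega) k0 k1
    (by omega)
  refine ⟨M2, a1.trans b1, by omega, by omega, ?_⟩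
  intro i j hi hj he
  have hM := hQ i j (by omega) (by omega) he
  have hγ : γ j < M.n := by
    obtain rfl | rfl | rfl : j = 0 ∨ j = 1 ∨ j = 2 := by omega
    all_goals omega
  have hM1 : M1.entry i (γ j) = true := by
    have := a4 (γ j) hγ
    obtain rfl | rfl | rfl : i = 0 ∨ i = 1 ∨ i = 2 := by omega
    · exact this.1 hM
    · exact this.2.1 hM
    · exact this.2.2 hM
  have := b4 i (by omega)
  obtain rfl | rfl | rfl : j = 0 ∨ j = 1 ∨ j = 2 := by omega
  · exact this.1 hM1
  · exact this.2.1 hM1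
  · exact this.2.2 hM1

def sel (a b c : ℕ) : ℕ → ℕ := fun i => if i = 0 then a else if i = 1 then b else c

end S7

open S7 in
/-- **Proposition.** If a pattern `P` avoids `Q₁, Q₂, Q₃, Q₄` as interval
minors, then `P` avoids `D₂`, or `P` avoids `D̄₂`, or `P` can be covered by
three lines. -/
theorem stmt_7 (P : BMat)
    (h1 : Avoids Q1 P) (h2 : Avoids Q2 P) (h3 : Avoids Q3 P) (h4 : Avoids Q4 P) :
    Avoids (D 2) P ∨ Avoids (Dbar 2) P ∨ CoveredByLines P 3 := by
  by_contra hcon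
  simp only [not_or, Avoids, not_not] at hcon
  obtain ⟨hD, hB, hC⟩ := hcon
  let S : ℕ × ℕ → Prop := fun x => x.1 < P.m ∧ x.2 < P.n ∧ P.entry x.1 x.2 = true
  obtain ⟨p, hp, hfree⟩ := konig (fun i j => S (i, j)) (max P.m P.n)
    (fun i j h => ⟨lt_max_of_lt_left h.1, lt_max_of_lt_right h.2.1⟩) (by
      rintro ⟨R, C, hcard, hcov⟩
      exact hC ⟨R, C, hcard, fun i j hi hj he => hcov i j ⟨hi, hj, he⟩⟩)
  have T := T_of_tri S (by
    rintro ⟨r0, x⟩ ⟨r1, y⟩ ⟨r2, z⟩ ⟨hx1, hx2, hx⟩ ⟨hy1, hy2, hy⟩ ⟨hz1, hz2, hz⟩ h01 h12 hxy hxz hyz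
    dsimp only at *
    have fin : ∀ Q : BMat, Q.m = 3 → Q.n = 3 → ∀ a b c, a < b → b < c → c < P.n →
        (∀ i j, i < 3 → j < 3 → Q.entry i j = true →
          P.entry (sel r0 r1 r2 i) (sel a b c j) = true) → IntervalMinor Q P := by
      intro Q hm hn a b c hab hbc hc hQ
      exact minor3 Q P hm hn (sel r0 r1 r2) (sel a b c) h01 h12 hz1 hab hbc hc hQ
    by_contra hbad
    rcases lt_or_gt_of_ne hxy with c1 | c1 <;> rcases lt_or_gt_of_ne hxz with c2 | c2 <;>
      rcases lt_or_gt_of_ne hyz with c3 | c3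
    · omega
    · refine h3 (fin Q3 rfl rfl x z y c2 c3 hy2 ?_)
      intro i j hi hj he
      simp [Q3] at he
      rcases he with (⟨rfl, rfl⟩ | ⟨rfl, rfl⟩) | ⟨rfl, rfl⟩ <;> simpa [sel]
    · omega
    · refine h2 (fin Q2 rfl rfl z x y c2 c1 hy2 ?_)
      intro i j hi hj he
      simp [Q2] at he
      rcases he with (⟨rfl, rfl⟩ | ⟨rfl, rfl⟩) | ⟨rfl, rfl⟩ <;> simpa [sel]
    · refine h1 (fin Q1 rfl rfl y x z c1 c2 hz2 ?_)
      intro i j hi hj he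
      simp [Q1] at he
      rcases he with (⟨rfl, rfl⟩ | ⟨rfl, rfl⟩) | ⟨rfl, rfl⟩ <;> simpa [sel]
    · omega
    · refine h4 (fin Q4 rfl rfl y z x c3 c2 hx2 ?_)
      intro i j hi hj he
      simp [Q4] at he
      rcases he with (⟨rfl, rfl⟩ | ⟨rfl, rfl⟩) | ⟨rfl, rfl⟩ <;> simpa [sel]
    · omega)
  have hcore := core S T p hp hfree
  have inc : incP (p 0) (p 1) := by
    obtain ⟨M', g1, g2, g3, g4⟩ := hD
    obtain ⟨φ, ψ, m1, m2, g5⟩ := origin g1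
    simp only [D] at g2 g3 g4
    obtain ⟨a, b, ha, hb, ham, hbn, hab⟩ := g5 0 0 (by omega) (by omega)
      (g4 0 0 (by omega) (by omega) rfl)
    obtain ⟨c, d, hc, hd, hcm, hdn, hcd⟩ := g5 1 1 (by omega) (by omega)
      (g4 1 1 (by omega) (by omega) rfl)
    have l1 : a < c := m1.reflect_lt (by omega)
    have l2 : b < d := m2.reflect_lt (by omega)
    exact (hcore (a, b) (c, d) ⟨ham, hbn, hab⟩ ⟨hcm, hdn, hcd⟩ ⟨l1.ne, l2.ne⟩).1
      ⟨fun _ => l2, fun _ => l1⟩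
  obtain ⟨M', g1, g2, g3, g4⟩ := hB
  obtain ⟨φ, ψ, m1, m2, g5⟩ := origin g1
  simp only [Dbar] at g2 g3 g4
  obtain ⟨a, b, ha, hb, ham, hbn, hab⟩ := g5 0 1 (by omega) (by omega)
    (g4 0 1 (by omega) (by omega) rfl)
  obtain ⟨c, d, hc, hd, hcm, hdn, hcd⟩ := g5 1 0 (by omega) (by omega)
    (g4 1 0 (by omega) (by omega) rfl)
  have l1 : a < c := m1.reflect_lt (by omega)
  have l2 : d < b := m2.reflect_lt (by omega)
  have := (hcore (a, b) (c, d) ⟨ham, hbn, hab⟩ ⟨hcm, hdn, hcd⟩ ⟨l1.ne, l2.ne'⟩).2 inc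
  have := this.1 l1
  dsimp only at this
  omega
end
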